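/- Suppose in addition that σ is convex and σ(0) = 0. Set K = K₁⁴ + 2K₁²K₂ + K₁⁴K₂², C_{η,m,T} = ρ^{−1} T^{−1/2} (m^{β−1/2} η^{−1/2} + √K) and D_{η,m,T} = √(ηT). Fix γ > 0, δ ∈ (0,1), and suppose β ∈ [0,1), m is even with m ≥ (16K₁²/ρ²)·log(2n/δ), 0 < η ≤ min{m^β, 4m^{2β−1}/(K₁² + K₂)}, and T ≤ ⌊mρ²/(32 η K₂² log 2)⌋. Then there exists a universal constant C > 0 such that with probability at least 1 − 3δ over the symmetric random initialization and the i.i.d. sample (x_i, y_i)_{i=1}^n ∼ ν^{⊗n}, the gradient descent iterates satisfy min_{t ∈ {0,…,T−1}} ν({(x, y) : y·f_{Θ^{(t)}}(x) ≤ 0}) ≤ C(1 + e^γ)·C_{η,m,T} + 3√(log(2/δ)/(2n)) + (C K₁ m^{1/2−β}/(γ√n))·( D_{η,m,T} + √(log(Am/δ)/b) ). -/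

import Mathlib

open MeasureTheory Real Finset
open scoped RealInnerProductSpace BigOperators

noncomputable section

/-- Two-layer network `f_Θ(x) = m^{-β} ∑_r a_r σ(θ_rᵀ x)`. -/
def fnet (d m : ℕ) (β : ℝ) (σ : ℝ → ℝ) (a : Fin m → ℝ)
    (Θ : Fin m → EuclideanSpace ℝ (Fin d)) (x : EuclideanSpace ℝ (Fin d)) : ℝ :=
  (m : ℝ) ^ (-β) * ∑ r, a r * σ ⟪Θ r, x⟫

/-- Functional-gradient value `g_Θ(x_i) = -y_i/(1+exp(y_i f_Θ(x_i)))`. -/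
def gval (d m n : ℕ) (β : ℝ) (σ : ℝ → ℝ) (a : Fin m → ℝ)
    (x : Fin n → EuclideanSpace ℝ (Fin d)) (y : Fin n → ℝ)
    (Θ : Fin m → EuclideanSpace ℝ (Fin d)) (i : Fin n) : ℝ :=
  - y i / (1 + Real.exp (y i * fnet d m β σ a Θ (x i)))

/-- Empirical logistic loss `L(Θ)`. -/
def eloss (d m n : ℕ) (β : ℝ) (σ : ℝ → ℝ) (a : Fin m → ℝ)
    (x : Fin n → EuclideanSpace ℝ (Fin d)) (y : Fin n → ℝ)
    (Θ : Fin m → EuclideanSpace ℝ (Fin d)) : ℝ :=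
  (1 / n : ℝ) * ∑ i, Real.log (1 + Real.exp (- y i * fnet d m β σ a Θ (x i)))

/-- `L¹(ν_n)`-norm of the functional gradient. -/
def L1norm (d m n : ℕ) (β : ℝ) (σ : ℝ → ℝ) (a : Fin m → ℝ)
    (x : Fin n → EuclideanSpace ℝ (Fin d)) (y : Fin n → ℝ)
    (Θ : Fin m → EuclideanSpace ℝ (Fin d)) : ℝ :=
  (1 / n : ℝ) * ∑ i, |gval d m n β σ a x y Θ i|

/-- Parameter gradient `∇_Θ L(Θ)`. -/
def gradL (d m n : ℕ) (β : ℝ) (σ : ℝ → ℝ) (a : Fin m → ℝ)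
    (x : Fin n → EuclideanSpace ℝ (Fin d)) (y : Fin n → ℝ)
    (Θ : Fin m → EuclideanSpace ℝ (Fin d)) : Fin m → EuclideanSpace ℝ (Fin d) :=
  fun r => (1 / n : ℝ) • ∑ i,
    (gval d m n β σ a x y Θ i * (a r * (m : ℝ) ^ (-β) * deriv σ ⟪Θ r, x i⟫)) • x i

/-- Squared Euclidean norm of a parameter block `‖Θ‖₂²`. -/
def nsq (d m : ℕ) (Θ : Fin m → EuclideanSpace ℝ (Fin d)) : ℝ := ∑ r, ‖Θ r‖ ^ 2

/-- Euclidean norm of a parameter block `‖Θ‖₂`. -/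
def en2 (d m : ℕ) (Θ : Fin m → EuclideanSpace ℝ (Fin d)) : ℝ := Real.sqrt (nsq d m Θ)

/-- The `(2,1)`-norm `‖Θ‖_{2,1} = ∑_r ‖θ_r‖₂`. -/
def n21 (d m : ℕ) (Θ : Fin m → EuclideanSpace ℝ (Fin d)) : ℝ := ∑ r, ‖Θ r‖

/-- Gradient-descent iterates `Θ^{(t+1)} = Θ^{(t)} - η ∇_Θ L(Θ^{(t)})`. -/
def gdSeq (d m n : ℕ) (β : ℝ) (σ : ℝ → ℝ) (a : Fin m → ℝ)
    (x : Fin n → EuclideanSpace ℝ (Fin d)) (y : Fin n → ℝ) (η : ℝ)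
    (Θ0 : Fin m → EuclideanSpace ℝ (Fin d)) : ℕ → Fin m → EuclideanSpace ℝ (Fin d)
  | 0 => Θ0
  | t + 1 => fun r => gdSeq d m n β σ a x y η Θ0 t r
      - η • gradL d m n β σ a x y (gdSeq d m n β σ a x y η Θ0 t) r

/-- Kernel-smoothing quantity `Q(Θ) = ‖(1/n) ∑_i g_Θ(x_i) ∇_Θ f_Θ(x_i)‖₂²`. -/
def Qker (d m n : ℕ) (β : ℝ) (σ : ℝ → ℝ) (a : Fin m → ℝ)
    (x : Fin n → EuclideanSpace ℝ (Fin d)) (y : Fin n → ℝ)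
    (Θ : Fin m → EuclideanSpace ℝ (Fin d)) : ℝ :=
  nsq d m (fun r => (1 / n : ℝ) • ∑ i,
    (gval d m n β σ a x y Θ i * (a r * (m : ℝ) ^ (-β) * deriv σ ⟪Θ r, x i⟫)) • x i)

/-- Symmetric signs: `a_r = 1` for `r < k`, `a_r = -1` for `r ≥ k` (with `m = 2k`). -/
def symSigns (k : ℕ) : Fin (2 * k) → ℝ := fun r => if (r : ℕ) < k then 1 else -1

/-- Symmetric initialization: `θ^{(0)}_{r+k} = θ^{(0)}_r` (with `m = 2k`). -/
def symInit (d k : ℕ) (ω : Fin k → EuclideanSpace ℝ (Fin d)) :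
    Fin (2 * k) → EuclideanSpace ℝ (Fin d) :=
  fun r => if h : (r : ℕ) < k then ω ⟨r, h⟩ else ω ⟨(r : ℕ) - k, by have := r.isLt; omega⟩

/-- Ramp loss with margin `γ`. -/
def ramp (γ v : ℝ) : ℝ := if v < 0 then 1 else if v ≤ γ then 1 - v / γ else 0

/-- Empirical Rademacher complexity of the ramp-loss class over the ball of radius `D`
around `Θ0`. -/
def rade (d m n : ℕ) (β γ D : ℝ) (σ : ℝ → ℝ) (a : Fin m → ℝ)
    (x : Fin n → EuclideanSpace ℝ (Fin d)) (y : Fin n → ℝ)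
    (Θ0 : Fin m → EuclideanSpace ℝ (Fin d)) : ℝ :=
  (1 / n : ℝ) * (1 / 2 ^ n : ℝ) * ∑ ε : Fin n → Bool,
    sSup {z : ℝ | ∃ Θ : Fin m → EuclideanSpace ℝ (Fin d),
      en2 d m (fun r => Θ r - Θ0 r) ≤ D ∧
      z = ∑ i, (if ε i then (1 : ℝ) else -1) * ramp γ (y i * fnet d m β σ a Θ (x i))}

/-- Neural tangent kernel. -/
def kNTK (d : ℕ) (σ : ℝ → ℝ) (μ₀ : Measure (EuclideanSpace ℝ (Fin d)))
    (x x' : EuclideanSpace ℝ (Fin d)) : ℝ :=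
  ∫ θ, deriv σ ⟪θ, x⟫ * deriv σ ⟪θ, x'⟫ * ⟪x, x'⟫ ∂μ₀

/-- The sign `±1` encoded by a Boolean. -/
def boolSign (b : Bool) : ℝ := if b then 1 else -1

lemma boolSign_not (b : Bool) : boolSign (!b) = -boolSign b := by cases b <;> simp [boolSign]

lemma boolSign_mul_self (b : Bool) : boolSign b * boolSign b = 1 := by
  cases b <;> simp [boolSign]

lemma boolSign_eq (b : Bool) : boolSign b = 1 ∨ boolSign b = -1 := by
  cases b <;> simp [boolSign]

/-- Flipping the `i`-th sign of a sign vector. -/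
def flipAt {n : ℕ} (i : Fin n) : (Fin n → Bool) ≃ (Fin n → Bool) :=
  Function.Involutive.toPerm (fun ε => Function.update ε i (!ε i)) (fun ε => by
    ext l; by_cases h : l = i
    · subst h; simp
    · simp [h])

lemma flipAt_apply {n : ℕ} (i : Fin n) (ε : Fin n → Bool) :
    flipAt i ε = Function.update ε i (!ε i) := rfl

lemma boolSign_flipAt_self {n : ℕ} (i : Fin n) (ε : Fin n → Bool) :
    boolSign (flipAt i ε i) = -boolSign (ε i) := by
  rw [flipAt_apply, Function.update_self, boolSign_not]

lemma boolSign_flipAt_of_ne {n : ℕ} {i l : Fin n} (h : l ≠ i) (ε : Fin n → Bool) :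
    boolSign (flipAt i ε l) = boolSign (ε l) := by
  rw [flipAt_apply, Function.update_of_ne h]

lemma sum_flipAt {n : ℕ} (i : Fin n) (Φ : (Fin n → Bool) → ℝ) :
    ∑ ε, Φ (flipAt i ε) = ∑ ε, Φ ε := Equiv.sum_comp _ _

lemma sum_boolSign_mul {n : ℕ} {i l : Fin n} (h : l ≠ i) :
    ∑ ε : Fin n → Bool, boolSign (ε i) * boolSign (ε l) = 0 := by
  have := sum_flipAt i (fun ε => boolSign (ε i) * boolSign (ε l))
  simp only [boolSign_flipAt_self, boolSign_flipAt_of_ne h, neg_mul, Finset.sum_neg_distrib] at this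
  linarith

/-- The sum over all sign vectors of the squared positive part of the supremum of the Rademacher
process indexed by the vectors `b j`. -/
def radSq {ι : Type*} {n : ℕ} (b : ι → Fin n → ℝ) : ℝ :=
  ∑ ε : Fin n → Bool, (max 0 (⨆ j, ∑ i, boolSign (ε i) * b j i)) ^ 2

lemma le_ciSup_finite {ι : Type*} [Finite ι] (f : ι → ℝ) (j : ι) : f j ≤ ⨆ j, f j :=
  le_ciSup (Set.finite_range f).bddAbove j

lemma sq_posPart_add_le {P Q M N : ℝ} (hs : P + Q ≤ M + N) (hP : P ≤ max M N)
    (hQ : Q ≤ max M N) :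
    (max 0 P) ^ 2 + (max 0 Q) ^ 2 ≤ (max 0 M) ^ 2 + (max 0 N) ^ 2 := by
  wlog hMN : N ≤ M generalizing M N
  · rw [add_comm ((max 0 M) ^ 2)]
    exact this (by linarith) (by rwa [max_comm]) (by rwa [max_comm]) (le_of_not_ge hMN)
  rw [max_eq_left hMN] at hP hQ
  wlog hPQ : Q ≤ P generalizing P Q
  · rw [add_comm ((max 0 P) ^ 2)]
    exact this (by linarith) hQ hP (le_of_not_ge hPQ)
  rcases le_total P 0 with h | h
  · rw [max_eq_left h, max_eq_left (hPQ.trans h)]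
    nlinarith [sq_nonneg (max 0 M), sq_nonneg (max 0 N)]
  rw [max_eq_right h, max_eq_right (h.trans hP)]
  rcases le_total Q 0 with h' | h'
  · rw [max_eq_left h']; nlinarith [sq_nonneg (max 0 N)]
  · rw [max_eq_right h']
    have h3 : N ≤ max 0 N := le_max_right _ _
    have h4 : 0 ≤ max 0 N := le_max_left _ _
    rcases le_total P (max 0 N) with h5 | h5
    · nlinarith
    · have h6 : Q ^ 2 ≤ (M + max 0 N - P) ^ 2 := pow_le_pow_left₀ h' (by linarith) 2
      nlinarith [mul_nonneg (sub_nonneg.2 hP) (sub_nonneg.2 h5)]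

lemma sq_posPart_iSup_add_le {ι : Type*} [Finite ι] [Nonempty ι] (a b c : ι → ℝ)
    (h1 : ∀ j j', |c j - c j'| ≤ |b j - b j'|) (h2 : ∀ j, |c j| ≤ |b j|) :
    (max 0 (⨆ j, (a j + c j))) ^ 2 + (max 0 (⨆ j, (a j - c j))) ^ 2 ≤
      (max 0 (⨆ j, (a j + b j))) ^ 2 + (max 0 (⨆ j, (a j - b j))) ^ 2 := by
  have hM := le_ciSup_finite (fun j => a j + b j)
  have hN := le_ciSup_finite (fun j => a j - b j)
  obtain ⟨s, hs⟩ := exists_eq_ciSup_of_finite (f := fun j => a j + c j)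
  obtain ⟨t, ht⟩ := exists_eq_ciSup_of_finite (f := fun j => a j - c j)
  have key : ∀ j, a j + |b j| ≤ max (⨆ j, (a j + b j)) (⨆ j, (a j - b j)) := by
    intro j
    rcases abs_cases (b j) with ⟨h, _⟩ | ⟨h, _⟩ <;> rw [h]
    · exact (hM j).trans (le_max_left _ _)
    · exact (hN j).trans (le_max_right _ _)
  apply sq_posPart_add_le
  · rw [← hs, ← ht]
    have h := (le_abs_self _).trans (h1 s t)
    have := hM s; have := hM t; have := hN s; have := hN t
    rcases abs_cases (b s - b t) with ⟨h', _⟩ | ⟨h', _⟩ <;> rw [h'] at h <;> linarith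
  · rw [← hs]
    exact le_trans (by linarith [le_abs_self (c s), h2 s]) (key s)
  · rw [← ht]
    exact le_trans (by linarith [neg_abs_le (c t), h2 t]) (key t)

/-- Contraction principle for the second moment of a Rademacher process. -/
lemma radSq_contraction {ι : Type*} [Finite ι] [Nonempty ι] {n : ℕ} (b c : ι → Fin n → ℝ)
    (h1 : ∀ j j' i, |c j i - c j' i| ≤ |b j i - b j' i|) (h2 : ∀ j i, |c j i| ≤ |b j i|) :
    radSq c ≤ radSq b := by
  classical
  suffices h : ∀ s : Finset (Fin n), radSq (fun j i => if i ∈ s then c j i else b j i) ≤ radSq b by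
    simpa using h Finset.univ
  intro s
  induction s using Finset.induction_on with
  | empty => simp
  | insert i s hi ih =>
    refine le_trans ?_ ih
    have two : ∀ Φ : (Fin n → Bool) → ℝ, ∑ ε, (Φ ε + Φ (flipAt i ε)) = 2 * ∑ ε, Φ ε := by
      intro Φ
      rw [Finset.sum_add_distrib, sum_flipAt]; ring
    unfold radSq
    refine le_of_mul_le_mul_left ?_ (zero_lt_two' ℝ)
    rw [← two, ← two]
    refine Finset.sum_le_sum fun ε _ => ?_
    set a : ι → ℝ := fun j => ∑ l ∈ Finset.univ.erase i,
      boolSign (ε l) * (if l ∈ s then c j l else b j l) with ha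
    have e1 : ∀ ε' : Fin n → Bool, (∀ l, l ≠ i → boolSign (ε' l) = boolSign (ε l)) → ∀ j,
        ∑ l, boolSign (ε' l) * (if l ∈ insert i s then c j l else b j l)
          = a j + boolSign (ε' i) * c j i := by
      intro ε' h j
      rw [← Finset.sum_erase_add _ _ (Finset.mem_univ i)]
      congr 1
      · refine Finset.sum_congr rfl fun l hl => ?_
        have hl := Finset.ne_of_mem_erase hl
        rw [h l hl]; simp [hl]
      · simp
    have e2 : ∀ ε' : Fin n → Bool, (∀ l, l ≠ i → boolSign (ε' l) = boolSign (ε l)) → ∀ j,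
        ∑ l, boolSign (ε' l) * (if l ∈ s then c j l else b j l)
          = a j + boolSign (ε' i) * b j i := by
      intro ε' h j
      rw [← Finset.sum_erase_add _ _ (Finset.mem_univ i)]
      congr 1
      · refine Finset.sum_congr rfl fun l hl => ?_
        rw [h l (Finset.ne_of_mem_erase hl)]
      · simp [hi]
    have hf : ∀ l, l ≠ i → boolSign (flipAt i ε l) = boolSign (ε l) :=
      fun l hl => boolSign_flipAt_of_ne hl ε
    simp only [e1 ε (fun _ _ => rfl), e2 ε (fun _ _ => rfl), e1 _ hf, e2 _ hf,
      boolSign_flipAt_self]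
    have := sq_posPart_iSup_add_le a (fun j => b j i) (fun j => c j i)
      (fun j j' => h1 j j' i) (fun j => h2 j i)
    rcases boolSign_eq (ε i) with h | h <;> rw [h]
    · simpa [sub_eq_add_neg] using this
    · simp only [neg_mul, one_mul, neg_neg]
      simp only [sub_eq_add_neg] at this
      linarith

lemma radSq_add_le {ι : Type*} [Finite ι] [Nonempty ι] {n : ℕ} (b c : ι → Fin n → ℝ) :
    radSq (fun j i => b j i + c j i) ≤ 2 * radSq b + 2 * radSq c := by
  unfold radSq
  rw [Finset.mul_sum, Finset.mul_sum, ← Finset.sum_add_distrib]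
  refine Finset.sum_le_sum fun ε _ => ?_
  set B := ⨆ j, ∑ i, boolSign (ε i) * b j i
  set C := ⨆ j, ∑ i, boolSign (ε i) * c j i
  have h : ⨆ j, ∑ i, boolSign (ε i) * (b j i + c j i) ≤ B + C := by
    refine ciSup_le fun j => ?_
    simp only [mul_add, Finset.sum_add_distrib]
    exact add_le_add (le_ciSup_finite (fun j => ∑ i, boolSign (ε i) * b j i) j)
      (le_ciSup_finite (fun j => ∑ i, boolSign (ε i) * c j i) j)
  have h2 : max 0 (⨆ j, ∑ i, boolSign (ε i) * (b j i + c j i)) ≤ max 0 B + max 0 C :=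
    max_le (by positivity)
      (h.trans (add_le_add (le_max_right _ _) (le_max_right _ _)))
  calc _ ≤ (max 0 B + max 0 C) ^ 2 := by gcongr
    _ ≤ _ := by nlinarith [sq_nonneg (max 0 B - max 0 C)]

lemma radSq_mul {ι : Type*} [Finite ι] [Nonempty ι] {n : ℕ} (b : ι → Fin n → ℝ) {r : ℝ}
    (hr : 0 ≤ r) : radSq (fun j i => r * b j i) = r ^ 2 * radSq b := by
  unfold radSq
  rw [Finset.mul_sum]
  refine Finset.sum_congr rfl fun ε _ => ?_
  have : ⨆ j, ∑ i, boolSign (ε i) * (r * b j i) = r * ⨆ j, ∑ i, boolSign (ε i) * b j i := by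
    rw [Real.mul_iSup_of_nonneg hr]
    congr 1; ext j
    rw [Finset.mul_sum]
    exact Finset.sum_congr rfl fun i _ => by ring
  rw [this, ← mul_pow]
  congr 1
  rw [mul_max_of_nonneg _ _ hr, mul_zero]

lemma sum_norm_sq_boolSign_smul {E : Type*} [NormedAddCommGroup E] [InnerProductSpace ℝ E] {n : ℕ}
    (x : Fin n → E) :
    ∑ ε : Fin n → Bool, ‖∑ i, boolSign (ε i) • x i‖ ^ 2 = 2 ^ n * ∑ i, ‖x i‖ ^ 2 := by
  have h : ∀ ε : Fin n → Bool, ‖∑ i, boolSign (ε i) • x i‖ ^ 2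
      = ∑ i, ∑ l, (boolSign (ε i) * boolSign (ε l)) * ⟪x i, x l⟫ := by
    intro ε
    rw [← real_inner_self_eq_norm_sq, sum_inner]
    refine Finset.sum_congr rfl fun i _ => ?_
    rw [inner_sum]
    refine Finset.sum_congr rfl fun l _ => ?_
    rw [real_inner_smul_left, real_inner_smul_right]; ring
  simp only [h]
  rw [Finset.sum_comm, Finset.mul_sum]
  refine Finset.sum_congr rfl fun i _ => ?_
  rw [Finset.sum_comm, Finset.sum_eq_single i]
  · simp [boolSign_mul_self]
  · intro l _ hl
    rw [← Finset.sum_mul, sum_boolSign_mul hl, zero_mul]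
  · simp

lemma radSq_inner_le {ι E : Type*} [Finite ι] [Nonempty ι] [NormedAddCommGroup E]
    [InnerProductSpace ℝ E] {n : ℕ} (w : ι → E) (x : Fin n → E) {R : ℝ} (hR : ∀ j, ‖w j‖ ≤ R)
    (hx : ∀ i, ‖x i‖ ≤ 1) :
    radSq (fun j i => ⟪w j, x i⟫) ≤ 2 ^ n * n * R ^ 2 := by
  have hR0 : 0 ≤ R := (norm_nonneg _).trans (hR (Classical.arbitrary ι))
  have h1 : radSq (fun j i => ⟪w j, x i⟫) ≤
      ∑ ε : Fin n → Bool, R ^ 2 * ‖∑ i, boolSign (ε i) • x i‖ ^ 2 := by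
    refine Finset.sum_le_sum fun ε _ => ?_
    rw [← mul_pow]
    refine pow_le_pow_left₀ (le_max_left _ _) (max_le (by positivity) (ciSup_le fun j => ?_)) 2
    have : ∑ i, boolSign (ε i) * ⟪w j, x i⟫ = ⟪w j, ∑ i, boolSign (ε i) • x i⟫ := by
      rw [inner_sum]
      exact Finset.sum_congr rfl fun i _ => by rw [real_inner_smul_right]
    rw [this]
    exact (real_inner_le_norm _ _).trans (by gcongr; exact hR j)
  rw [← Finset.mul_sum, sum_norm_sq_boolSign_smul] at h1
  have h2 : ∑ i, ‖x i‖ ^ 2 ≤ n := by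
    calc _ ≤ ∑ i : Fin n, (1 : ℝ) :=
          Finset.sum_le_sum fun i _ => pow_le_one₀ (norm_nonneg _) (hx i)
      _ = n := by simp
  calc _ ≤ _ := h1
    _ ≤ R ^ 2 * (2 ^ n * n) := by gcongr
    _ = _ := by ring

/-- The average slope of `σ` between `c` and `c + z`. -/
def avgSlope (σ : ℝ → ℝ) (c z : ℝ) : ℝ := ∫ t in (0 : ℝ)..1, deriv σ (c + t * z)

lemma ContDiff.continuous_deriv_two {σ : ℝ → ℝ} (hσ : ContDiff ℝ 2 σ) : Continuous (deriv σ) :=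
  hσ.continuous_deriv (by norm_num)

lemma ContDiff.differentiable_deriv_two' {σ : ℝ → ℝ} (hσ : ContDiff ℝ 2 σ) :
    Differentiable ℝ (deriv σ) := by
  have h : ContDiff ℝ 1 (deriv σ) := by
    have := (contDiff_succ_iff_deriv (n := 1) (f := σ) (𝕜 := ℝ)).1 (by norm_num; exact hσ)
    exact this.2.2
  exact h.differentiable (by norm_num)

lemma abs_sub_le_of_abs_deriv_le {f : ℝ → ℝ} {K : ℝ} (hf : Differentiable ℝ f)
    (hK : ∀ z, |deriv f z| ≤ K) (x y : ℝ) : |f x - f y| ≤ K * |x - y| := by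
  simpa [Real.norm_eq_abs] using
    Convex.norm_image_sub_le_of_norm_deriv_le (s := Set.univ) (f := f) (C := K)
      (fun z _ => hf z) (fun z _ => by simpa using hK z) convex_univ (Set.mem_univ y)
      (Set.mem_univ x)

lemma avgSlope_mul {σ : ℝ → ℝ} (hσ : ContDiff ℝ 2 σ) (c z : ℝ) :
    avgSlope σ c z * z = σ (c + z) - σ c := by
  have hd : ∀ t ∈ Set.uIcc (0 : ℝ) 1,
      HasDerivAt (fun t => σ (c + t * z)) (deriv σ (c + t * z) * z) t := by
    intro t _
    have h1 : HasDerivAt σ (deriv σ (c + t * z)) (c + t * z) :=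
      (hσ.differentiable (by norm_num) _).hasDerivAt
    have h2 : HasDerivAt (fun t : ℝ => c + t * z) z t := by
      simpa using ((hasDerivAt_id t).mul_const z).const_add c
    exact h1.comp t h2
  have hc := hσ.continuous_deriv_two
  have := intervalIntegral.integral_eq_sub_of_hasDerivAt hd
    (Continuous.intervalIntegrable (by fun_prop) _ _)
  rw [avgSlope, ← intervalIntegral.integral_mul_const, this]
  simp

lemma abs_avgSlope_sub_le {σ : ℝ → ℝ} {K₂ : ℝ} (hσ : ContDiff ℝ 2 σ)
    (hK₂ : ∀ z, |deriv (deriv σ) z| ≤ K₂) (c z z' : ℝ) :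
    |avgSlope σ c z - avgSlope σ c z'| ≤ K₂ * |z - z'| := by
  have hK : 0 ≤ K₂ := (abs_nonneg _).trans (hK₂ 0)
  have hc := hσ.continuous_deriv_two
  rw [avgSlope, avgSlope, ← intervalIntegral.integral_sub
    (Continuous.intervalIntegrable (by fun_prop) _ _)
    (Continuous.intervalIntegrable (by fun_prop) _ _)]
  have := intervalIntegral.norm_integral_le_of_norm_le_const (a := (0 : ℝ)) (b := 1)
    (f := fun t => deriv σ (c + t * z) - deriv σ (c + t * z')) (C := K₂ * |z - z'|) (by
      intro t ht
      rw [Set.uIoc_of_le zero_le_one] at ht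
      refine (abs_sub_le_of_abs_deriv_le hσ.differentiable_deriv_two' hK₂ _ _).trans
        (mul_le_mul_of_nonneg_left ?_ hK)
      rw [show c + t * z - (c + t * z') = t * (z - z') by ring, abs_mul, abs_of_pos ht.1]
      exact mul_le_of_le_one_left (abs_nonneg _) ht.2)
  simpa using this

lemma abs_avgSlope_le {σ : ℝ → ℝ} {K₁ : ℝ} (hK₁ : ∀ z, |deriv σ z| ≤ K₁) (c z : ℝ) :
    |avgSlope σ c z| ≤ K₁ := by
  have := intervalIntegral.norm_integral_le_of_norm_le_const (a := (0 : ℝ)) (b := 1)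
    (f := fun t => deriv σ (c + t * z)) (C := K₁) (fun t _ => hK₁ _)
  simpa [avgSlope] using this

/-- Second moment bound for the Rademacher process of products of two Rademacher-bounded
families. -/
lemma radSq_mul_le {ι : Type*} [Finite ι] [Nonempty ι] {n : ℕ} (p q : ι → Fin n → ℝ) {K V : ℝ}
    (hK : 0 ≤ K) (hp : ∀ j i, |p j i| ≤ 2) (hq : ∀ j i, |q j i| ≤ 1)
    (hpV : radSq p ≤ V) (hqV : radSq q ≤ V) :
    radSq (fun j i => K * (p j i * q j i)) ≤ K ^ 2 * (36 * V) := by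
  have key : ∀ s : ℝ, |s| = 1 →
      radSq (fun j i => s * (p j i + s * q j i) ^ 2 / 4) ≤ 9 / 4 * (4 * V) := by
    intro s hs
    have hss : s * s = 1 := by rw [← abs_mul_abs_self, hs, one_mul]
    have hsum : radSq (fun j i => p j i + s * q j i) ≤ 4 * V := by
      refine (radSq_add_le p (fun j i => s * q j i)).trans ?_
      have : radSq (fun j i => s * q j i) ≤ radSq q :=
        radSq_contraction _ _ (fun j j' i => by rw [← mul_sub, abs_mul, hs, one_mul])
          (fun j i => by rw [abs_mul, hs, one_mul])
      linarith
    have hb : ∀ j i, |p j i + s * q j i| ≤ 3 := fun j i => by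
      refine (abs_add_le _ _).trans ?_
      rw [abs_mul, hs, one_mul]
      linarith [hp j i, hq j i]
    refine (radSq_contraction (fun j i => 3 / 2 * (p j i + s * q j i)) _ ?_ ?_).trans ?_
    · intro j j' i
      set x := p j i + s * q j i with hx
      set y := p j' i + s * q j' i with hy
      rw [show s * x ^ 2 / 4 - s * y ^ 2 / 4 = s * ((x + y) / 4 * (x - y)) by ring, abs_mul, hs,
        one_mul, ← mul_sub, abs_mul, abs_mul, abs_of_pos (by norm_num : (0 : ℝ) < 3 / 2)]
      gcongr
      rw [abs_div, abs_of_pos (by norm_num : (0 : ℝ) < 4)]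
      have := abs_add_le x y
      have := hb j i
      have := hb j' i
      linarith
    · intro j i
      set x := p j i + s * q j i with hx
      rw [show s * x ^ 2 / 4 = s * (x / 4 * x) by ring, abs_mul, hs, one_mul, abs_mul, abs_mul,
        abs_of_pos (by norm_num : (0 : ℝ) < 3 / 2)]
      gcongr
      rw [abs_div, abs_of_pos (by norm_num : (0 : ℝ) < 4)]
      have := hb j i
      linarith
    · rw [radSq_mul _ (by norm_num : (0 : ℝ) ≤ 3 / 2)]
      linarith
  have h1 := key 1 (by simp)
  have h2 := key (-1) (by simp)
  have h3 := radSq_add_le (fun j i => 1 * (p j i + 1 * q j i) ^ 2 / 4)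
    (fun j i => -1 * (p j i + -1 * q j i) ^ 2 / 4)
  rw [radSq_mul (fun j i => p j i * q j i) hK]
  gcongr
  have e : (fun j i => p j i * q j i) = fun j i => 1 * (p j i + 1 * q j i) ^ 2 / 4 +
      -1 * (p j i + -1 * q j i) ^ 2 / 4 := by
    ext j i; ring
  rw [e]
  linarith

lemma radSq_neuron_le {ι E : Type*} [Finite ι] [Nonempty ι] [NormedAddCommGroup E]
    [InnerProductSpace ℝ E] {n : ℕ} {σ : ℝ → ℝ} {K₁ K₂ : ℝ} (hσ : ContDiff ℝ 2 σ)
    (hK₁ : ∀ z, |deriv σ z| ≤ K₁) (hK₂ : ∀ z, |deriv (deriv σ) z| ≤ K₂) (h1 : 0 < K₁)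
    (h2 : 0 < K₂) {a : ℝ} (ha : |a| = 1) (c : Fin n → ℝ) (Δ u : ι → E) (x : Fin n → E)
    (hΔ : ∀ j, ‖Δ j‖ ≤ 3 * K₁ / K₂) (hu : ∀ j, ‖u j‖ ≤ 1) (hx : ∀ i, ‖x i‖ ≤ 1) :
    radSq (fun j i => a * avgSlope σ (c i) ⟪Δ j, x i⟫ * ⟪u j, x i⟫)
      ≤ 2 ^ n * n * (30 * K₁) ^ 2 := by
  set q : ι → Fin n → ℝ := fun j i => ⟪u j, x i⟫ with hq
  set p : ι → Fin n → ℝ := fun j i =>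
    a * (avgSlope σ (c i) ⟪Δ j, x i⟫ - avgSlope σ (c i) 0) / K₁ with hp
  have hqV : radSq q ≤ 2 ^ n * n * 1 ^ 2 := radSq_inner_le u x hu hx
  have hpV : radSq p ≤ 2 ^ n * n * 3 ^ 2 := by
    refine (radSq_contraction (fun j i => (⟪(K₂ / K₁) • Δ j, x i⟫ : ℝ)) p ?_ ?_).trans
      (radSq_inner_le _ x (fun j => ?_) hx)
    · intro j j' i
      have := abs_avgSlope_sub_le hσ hK₂ (c i) ⟪Δ j, x i⟫ ⟪Δ j', x i⟫
      rw [hp]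
      simp only
      rw [real_inner_smul_left, real_inner_smul_left, ← mul_sub, ← sub_div, ← mul_sub, abs_mul,
        abs_div, abs_mul, ha, one_mul, sub_sub_sub_cancel_right, abs_of_pos h1,
        abs_of_pos (div_pos h2 h1), div_mul_eq_mul_div]
      gcongr
    · intro j i
      have := abs_avgSlope_sub_le hσ hK₂ (c i) ⟪Δ j, x i⟫ 0
      rw [sub_zero] at this
      rw [hp]
      simp only
      rw [real_inner_smul_left, abs_div, abs_mul, ha, one_mul, abs_mul, abs_of_pos h1,
        abs_of_pos (div_pos h2 h1), div_mul_eq_mul_div]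
      gcongr
    · rw [norm_smul, Real.norm_of_nonneg (div_pos h2 h1).le]
      calc K₂ / K₁ * ‖Δ j‖ ≤ K₂ / K₁ * (3 * K₁ / K₂) := by gcongr; exact hΔ j
        _ = 3 := by field_simp
  have hqb : ∀ j i, |q j i| ≤ 1 := fun j i =>
    (abs_real_inner_le_norm _ _).trans (mul_le_one₀ (hu j) (norm_nonneg _) (hx i))
  have hpb : ∀ j i, |p j i| ≤ 2 := fun j i => by
    rw [hp]
    simp only
    rw [abs_div, abs_mul, ha, one_mul, abs_of_pos h1, div_le_iff₀ h1]
    have := abs_avgSlope_le hK₁ (c i) ⟪Δ j, x i⟫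
    have := abs_avgSlope_le hK₁ (c i) 0
    exact (abs_sub _ _).trans (by linarith)
  have hprod := radSq_mul_le p q h1.le hpb hqb hpV
    (hqV.trans (by gcongr; norm_num))
  have hlin : radSq (fun j i => a * avgSlope σ (c i) 0 * q j i) ≤ K₁ ^ 2 * (2 ^ n * n) := by
    refine (radSq_contraction (fun j i => K₁ * q j i) _ ?_ ?_).trans ?_
    · intro j j' i
      rw [← mul_sub, ← mul_sub, abs_mul, abs_mul, abs_mul, ha, one_mul, abs_of_pos h1]
      gcongr
      exact abs_avgSlope_le hK₁ _ _
    · intro j i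
      rw [abs_mul, abs_mul, abs_mul, ha, one_mul, abs_of_pos h1]
      gcongr
      exact abs_avgSlope_le hK₁ _ _
    · rw [radSq_mul _ h1.le]
      gcongr
      linarith
  have hadd := radSq_add_le (fun j i => a * avgSlope σ (c i) 0 * q j i)
    (fun j i => K₁ * (p j i * q j i))
  have e : (fun j i => a * avgSlope σ (c i) ⟪Δ j, x i⟫ * ⟪u j, x i⟫) =
      fun j i => a * avgSlope σ (c i) 0 * q j i + K₁ * (p j i * q j i) := by
    ext j i
    rw [hp]
    field_simp
    rw [hq]
    ring
  rw [e]
  have : (0 : ℝ) ≤ K₁ ^ 2 * (2 ^ n * n) := by positivity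
  nlinarith

lemma radSq_network_le {ι E : Type*} [Finite ι] [Nonempty ι] [NormedAddCommGroup E]
    [InnerProductSpace ℝ E] {m n : ℕ} {σ : ℝ → ℝ} {K₁ K₂ D : ℝ} (hσ : ContDiff ℝ 2 σ)
    (hK₁ : ∀ z, |deriv σ z| ≤ K₁) (hK₂ : ∀ z, |deriv (deriv σ) z| ≤ K₂) (h1 : 0 < K₁)
    (h2 : 0 < K₂) {a : Fin m → ℝ} (ha : ∀ r, |a r| = 1) (Θ : Fin m → E) (Δ : ι → Fin m → E)
    (x : Fin n → E) (hΔ : ∀ j r, ‖Δ j r‖ ≤ 3 * K₁ / K₂) (hD : ∀ j, ∑ r, ‖Δ j r‖ ^ 2 ≤ D)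
    (hx : ∀ i, ‖x i‖ ≤ 1) :
    radSq (fun j i => ∑ r, a r * (σ ⟪Θ r + Δ j r, x i⟫ - σ ⟪Θ r, x i⟫))
      ≤ D * (m * (2 ^ n * n * (30 * K₁) ^ 2)) := by
  have hD0 : 0 ≤ D :=
    le_trans (by positivity) (hD (Classical.arbitrary ι))
  set u : ι → Fin m → E := fun j r => ‖Δ j r‖⁻¹ • Δ j r with hu
  have hu1 : ∀ j r, ‖u j r‖ ≤ 1 := fun j r => by
    rw [hu]; simp only
    rw [norm_smul, norm_inv, norm_norm]
    exact inv_mul_le_one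
  set b : Fin m → ι → Fin n → ℝ := fun r j i =>
    a r * avgSlope σ ⟪Θ r, x i⟫ ⟪Δ j r, x i⟫ * ⟪u j r, x i⟫ with hb
  have hbr : ∀ r, radSq (b r) ≤ 2 ^ n * n * (30 * K₁) ^ 2 := fun r =>
    radSq_neuron_le hσ hK₁ hK₂ h1 h2 (ha r) (fun i => ⟪Θ r, x i⟫) (fun j => Δ j r)
      (fun j => u j r) x (fun j => hΔ j r) (fun j => hu1 j r) hx
  have hterm : ∀ j r i, a r * (σ ⟪Θ r + Δ j r, x i⟫ - σ ⟪Θ r, x i⟫) = ‖Δ j r‖ * b r j i := by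
    intro j r i
    rw [inner_add_left, ← avgSlope_mul hσ, hb, hu]
    simp only
    rw [real_inner_smul_left]
    rcases eq_or_ne (Δ j r) 0 with h | h
    · simp [h]
    · have := norm_ne_zero_iff.2 h
      field_simp
  have hpt : radSq (fun j i => ∑ r, a r * (σ ⟪Θ r + Δ j r, x i⟫ - σ ⟪Θ r, x i⟫)) ≤
      D * ∑ r, radSq (b r) := by
    unfold radSq
    rw [Finset.sum_comm, Finset.mul_sum]
    refine Finset.sum_le_sum fun ε _ => ?_
    set X : Fin m → ℝ := fun r => max 0 (⨆ j, ∑ i, boolSign (ε i) * b r j i) with hX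
    have hX0 : ∀ r, 0 ≤ X r := fun r => le_max_left _ _
    rw [← Real.sqrt_le_sqrt_iff (by positivity), Real.sqrt_sq (le_max_left _ _)]
    refine max_le (Real.sqrt_nonneg _) (ciSup_le fun j => ?_)
    have e : ∑ i, boolSign (ε i) * ∑ r, a r * (σ ⟪Θ r + Δ j r, x i⟫ - σ ⟪Θ r, x i⟫)
        = ∑ r, ‖Δ j r‖ * ∑ i, boolSign (ε i) * b r j i := by
      simp only [hterm, Finset.mul_sum]
      rw [Finset.sum_comm]
      exact Finset.sum_congr rfl fun r _ => Finset.sum_congr rfl fun i _ => by ring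
    rw [e]
    calc _ ≤ ∑ r, ‖Δ j r‖ * X r := by
          refine Finset.sum_le_sum fun r _ => mul_le_mul_of_nonneg_left ?_ (norm_nonneg _)
          exact (le_ciSup_finite (fun j => ∑ i, boolSign (ε i) * b r j i) j).trans
            (le_max_right _ _)
      _ ≤ √(∑ r, ‖Δ j r‖ ^ 2) * √(∑ r, X r ^ 2) := Real.sum_mul_le_sqrt_mul_sqrt _ _ _
      _ ≤ √D * √(∑ r, X r ^ 2) := by gcongr; exact hD j
      _ = _ := by rw [Real.sqrt_mul hD0]
  refine hpt.trans (mul_le_mul_of_nonneg_left ?_ hD0)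
  calc _ ≤ ∑ r : Fin m, 2 ^ n * n * (30 * K₁) ^ 2 := Finset.sum_le_sum fun r _ => hbr r
    _ = _ := by simp

lemma integrable_of_abs_le {Z : Type*} [MeasurableSpace Z] {ν : Measure Z} [IsFiniteMeasure ν]
    {f : Z → ℝ} (hf : Measurable f) {M : ℝ} (hM : ∀ z, |f z| ≤ M) : Integrable f ν :=
  Integrable.of_bound hf.aestronglyMeasurable M (ae_of_all _ hM)

lemma abs_integral_le_of_abs_le {Z : Type*} [MeasurableSpace Z] {ν : Measure Z}
    [IsProbabilityMeasure ν] {f : Z → ℝ} {M : ℝ} (hM : ∀ z, |f z| ≤ M) : |∫ z, f z ∂ν| ≤ M := by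
  simpa using norm_integral_le_of_norm_le_const (μ := ν) (f := f) (C := M) (ae_of_all _ hM)

/-- Hoeffding's lemma for a function that varies by at most `c`. -/
lemma integral_exp_sub_integral_le {Z : Type*} [MeasurableSpace Z] (ν : Measure Z)
    [IsProbabilityMeasure ν] {f : Z → ℝ} (hf : Measurable f) {c : ℝ}
    (hc : ∀ w w', |f w - f w'| ≤ c) (l : ℝ) :
    ∫ w, exp (l * (f w - ∫ w', f w' ∂ν)) ∂ν ≤ exp (c ^ 2 * l ^ 2 / 2) := by
  obtain ⟨w₀⟩ : Nonempty Z := nonempty_of_isProbabilityMeasure ν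
  have h := (ProbabilityTheory.hasSubgaussianMGF_of_mem_Icc (μ := ν) (X := f) (a := f w₀ - c)
    (b := f w₀ + c) hf.aemeasurable (ae_of_all _ fun w => by
      have := abs_le.1 (hc w w₀)
      constructor <;> linarith)).mgf_le l
  have e : (((‖f w₀ + c - (f w₀ - c)‖₊ / 2) ^ 2 : NNReal) : ℝ) = c ^ 2 := by
    push_cast
    rw [show f w₀ + c - (f w₀ - c) = 2 * c by ring, Real.norm_eq_abs, div_pow, sq_abs]
    ring
  rw [e] at h
  exact h

/-- McDiarmid's inequality (in terms of the moment generating function) for functions with bounded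
differences of i.i.d. variables. -/
lemma integral_exp_pi_le_of_bounded_diff {Z : Type*} [MeasurableSpace Z] (ν : Measure Z)
    [IsProbabilityMeasure ν] {c M : ℝ} (l : ℝ) (n : ℕ) (G : (Fin n → Z) → ℝ)
    (hG : Measurable G) (hM : ∀ z, |G z| ≤ M)
    (hc : ∀ z i w, |G (Function.update z i w) - G z| ≤ c) :
    ∫ z, exp (l * (G z - ∫ z', G z' ∂(Measure.pi fun _ => ν))) ∂(Measure.pi fun _ => ν)
      ≤ exp (n * (c ^ 2 * l ^ 2 / 2)) := by
  induction n with
  | zero =>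
    have h : ∀ z, G z = G default := fun z => congrArg G (Subsingleton.elim _ _)
    simp [h]
  | succ n ih =>
    set μn : Measure (Fin n → Z) := Measure.pi fun _ => ν with hμn
    have hM0 : 0 ≤ M := by
      obtain ⟨w₀⟩ : Nonempty Z := nonempty_of_isProbabilityMeasure ν
      exact (abs_nonneg _).trans (hM fun _ => w₀)
    set e := (MeasurableEquiv.piFinSuccAbove (fun _ : Fin (n + 1) => Z) 0).symm with he
    have mp : MeasurePreserving e (ν.prod μn) (Measure.pi fun _ : Fin (n + 1) => ν) :=
      (measurePreserving_piFinSuccAbove (fun _ : Fin (n + 1) => ν) 0).symm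
    have hcons : ∀ w z, e (w, z) = Fin.cons w z := fun w z => by
      rw [he, MeasurableEquiv.piFinSuccAbove_symm_apply]
      exact Fin.insertNth_zero' w z
    have hH : Measurable fun p : Z × (Fin n → Z) => G (e p) := hG.comp e.measurable
    set g : (Fin n → Z) → ℝ := fun z => ∫ w, G (e (w, z)) ∂ν with hg
    have hgm : Measurable g := (hH.stronglyMeasurable.integral_prod_left').measurable
    have hgM : ∀ z, |g z| ≤ M := fun z => abs_integral_le_of_abs_le fun w => hM _
    have hsec : ∀ z, Measurable fun w => G (e (w, z)) := fun z =>
      hH.comp (measurable_id.prodMk measurable_const)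
    have hGint : ∫ z, G z ∂(Measure.pi fun _ : Fin (n + 1) => ν) = ∫ z, g z ∂μn := by
      rw [← mp.integral_comp', integral_prod_symm _ (integrable_of_abs_le hH fun p => hM _)]
    have hgc : ∀ z i w, |g (Function.update z i w) - g z| ≤ c := by
      intro z i w
      rw [hg]
      simp only
      rw [← integral_sub (integrable_of_abs_le (hsec _) fun _ => hM _)
        (integrable_of_abs_le (hsec _) fun _ => hM _)]
      refine abs_integral_le_of_abs_le fun w' => ?_
      rw [hcons, hcons, Fin.cons_update]
      exact hc _ _ _
    have ihg := ih g hgm hgM hgc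
    rw [hGint, ← mp.integral_comp']
    set μG := ∫ z, g z ∂μn with hμG
    have hμM : |μG| ≤ M := abs_integral_le_of_abs_le hgM
    have hbd : ∀ x : ℝ, |x| ≤ 2 * M → |exp (l * x)| ≤ exp (|l| * (2 * M)) := fun x hx => by
      rw [abs_of_pos (exp_pos _)]
      refine exp_le_exp.2 ((le_abs_self _).trans ?_)
      rw [abs_mul]
      gcongr
    have hsub : ∀ x y : ℝ, |x| ≤ M → |y| ≤ M → |x - y| ≤ 2 * M := fun x y hx hy =>
      (abs_sub _ _).trans (by linarith)
    rw [integral_prod_symm _ (integrable_of_abs_le (by fun_prop)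
      fun p => hbd _ (hsub _ _ (hM _) hμM))]
    calc ∫ z, ∫ w, exp (l * (G (e (w, z)) - μG)) ∂ν ∂μn
        ≤ ∫ z, exp (c ^ 2 * l ^ 2 / 2) * exp (l * (g z - μG)) ∂μn := by
          refine integral_mono_of_nonneg (ae_of_all _ fun z => integral_nonneg fun w =>
            (exp_pos _).le) ?_ (ae_of_all _ fun z => ?_)
          · exact (integrable_of_abs_le (by fun_prop)
              fun z => hbd _ (hsub _ _ (hgM z) hμM)).const_mul _
          · have h1 : ∀ w, exp (l * (G (e (w, z)) - μG)) =
                exp (l * (G (e (w, z)) - g z)) * exp (l * (g z - μG)) := fun w => by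
              rw [← exp_add]; ring_nf
            simp only [h1]
            rw [integral_mul_const]
            gcongr
            refine integral_exp_sub_integral_le ν (hsec z) (fun w w' => ?_) l
            have := hc (e (w', z)) 0 w
            rwa [hcons, Fin.update_cons_zero, ← hcons, ← hcons] at this
      _ = exp (c ^ 2 * l ^ 2 / 2) * ∫ z, exp (l * (g z - μG)) ∂μn := integral_const_mul _ _
      _ ≤ exp (c ^ 2 * l ^ 2 / 2) * exp (n * (c ^ 2 * l ^ 2 / 2)) := by gcongr
      _ = _ := by rw [← exp_add]; push_cast; ring_nf

/-- McDiarmid's inequality with (non-optimal) constant `1 / 2`. -/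
lemma measure_pi_ge_le_of_bounded_diff {Z : Type*} [MeasurableSpace Z] (ν : Measure Z)
    [IsProbabilityMeasure ν] {M : ℝ} {n : ℕ} (hn : 0 < n) (G : (Fin n → Z) → ℝ)
    (hG : Measurable G) (hM : ∀ z, |G z| ≤ M)
    (hc : ∀ z i w, |G (Function.update z i w) - G z| ≤ 1 / n) {B t : ℝ} (ht : 0 ≤ t)
    (hB : ∫ z, G z ∂(Measure.pi fun _ => ν) ≤ B) :
    (Measure.pi fun _ => ν) {z | B + t ≤ G z} ≤ ENNReal.ofReal (exp (-(n * t ^ 2 / 2))) := by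
  set P : Measure (Fin n → Z) := Measure.pi fun _ => ν with hP
  have hn' : (0 : ℝ) < n := by exact_mod_cast hn
  set m := ∫ z, G z ∂P with hm
  have hmM : |m| ≤ M := abs_integral_le_of_abs_le hM
  have h1 := integral_exp_pi_le_of_bounded_diff ν (n * t) n G hG hM hc
  rw [← hP, ← hm] at h1
  have hGint : Integrable (fun z => exp (n * t * (G z - m))) P := by
    refine integrable_of_abs_le (M := exp (n * t * (2 * M))) (by fun_prop) fun z => ?_
    rw [abs_of_pos (exp_pos _)]
    refine exp_le_exp.2 (mul_le_mul_of_nonneg_left ?_ (by positivity))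
    linarith [(abs_le.1 (hM z)).2, (abs_le.1 hmM).1]
  have h2 := ProbabilityTheory.measure_ge_le_exp_mul_mgf (μ := P) (X := fun z => G z - m) t
    (t := n * t) (by positivity) hGint
  have h3 : P.real {z | t ≤ G z - m} ≤ exp (-(n * t ^ 2 / 2)) := by
    refine h2.trans ?_
    calc _ ≤ exp (-(n * t) * t) * exp (n * ((1 / n) ^ 2 * (n * t) ^ 2 / 2)) := by
          unfold ProbabilityTheory.mgf
          gcongr
      _ = _ := by rw [← exp_add]; congr 1; field_simp; ring
  calc P {z | B + t ≤ G z} ≤ P {z | t ≤ G z - m} :=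
        measure_mono fun z hz => by
          simp only [Set.mem_ofPred_eq] at hz ⊢
          linarith
    _ = ENNReal.ofReal (P.real {z | t ≤ G z - m}) := by simp
    _ ≤ _ := ENNReal.ofReal_le_ofReal h3

lemma abs_ciSup_le_of_abs_le {ι : Type*} [Finite ι] [Nonempty ι] {f : ι → ℝ} {M : ℝ}
    (h : ∀ j, |f j| ≤ M) : |⨆ j, f j| ≤ M := by
  obtain ⟨j, hj⟩ := exists_eq_ciSup_of_finite (f := f)
  rw [← hj]; exact h j

lemma abs_sum_fin_le {n : ℕ} {f : Fin n → ℝ} {c : ℝ} (h : ∀ i, |f i| ≤ c) :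
    |∑ i, f i| ≤ n * c := by
  refine (Finset.abs_sum_le_sum_abs _ _).trans ?_
  calc _ ≤ ∑ _i : Fin n, c := Finset.sum_le_sum fun i _ => h i
    _ = _ := by simp

/-- The sum over all sign vectors of the supremum of a Rademacher process. -/
def radSum {ι : Type*} {n : ℕ} (b : ι → Fin n → ℝ) : ℝ :=
  ∑ ε : Fin n → Bool, ⨆ j, ∑ i, boolSign (ε i) * b j i

lemma radSum_le_of_radSq_le {ι : Type*} {n : ℕ} (b : ι → Fin n → ℝ) {V : ℝ} (hV : 0 ≤ V)
    (h : radSq b ≤ 2 ^ n * V ^ 2) : radSum b ≤ 2 ^ n * V := by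
  set X : (Fin n → Bool) → ℝ := fun ε => max 0 (⨆ j, ∑ i, boolSign (ε i) * b j i) with hX
  have h1 : radSum b ≤ ∑ ε, X ε := Finset.sum_le_sum fun ε _ => le_max_right _ _
  have h2 : (∑ ε, X ε) ^ 2 ≤ (2 ^ n * V) ^ 2 := by
    have := sq_sum_le_card_mul_sum_sq (s := Finset.univ) (f := X)
    simp only [Finset.card_univ, Fintype.card_fun, Fintype.card_bool, Fintype.card_fin,
      Nat.cast_pow, Nat.cast_ofNat] at this
    refine this.trans ?_
    calc (2 : ℝ) ^ n * ∑ ε, X ε ^ 2 ≤ 2 ^ n * (2 ^ n * V ^ 2) := by gcongr; exact h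
      _ = _ := by ring
  exact h1.trans (le_of_sq_le_sq h2 (by positivity))

/-- Swap the two entries of those pairs whose sign is `false`. -/
def swapPairs {Z : Type*} {n : ℕ} (ε : Fin n → Bool) (p : Fin n → Z × Z) : Fin n → Z × Z :=
  fun i => (if ε i then id else Prod.swap) (p i)

lemma measurePreserving_swapPairs {Z : Type*} [MeasurableSpace Z] (ν : Measure Z)
    [IsProbabilityMeasure ν] {n : ℕ} (ε : Fin n → Bool) :
    MeasurePreserving (swapPairs (Z := Z) ε) (Measure.pi fun _ => ν.prod ν)
      (Measure.pi fun _ => ν.prod ν) := by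
  refine measurePreserving_pi _ _ fun i => ?_
  by_cases h : ε i
  · simpa [h] using MeasurePreserving.id _
  · simpa [h] using Measure.measurePreserving_swap

lemma sum_swapPairs {Z : Type*} {n : ℕ} (h : Z → ℝ) (ε : Fin n → Bool) (p : Fin n → Z × Z) :
    ∑ i, (h (swapPairs ε p i).2 - h (swapPairs ε p i).1) =
      ∑ i, boolSign (ε i) * (h (p i).2 - h (p i).1) := by
  refine Finset.sum_congr rfl fun i _ => ?_
  by_cases hi : ε i <;> simp [hi, swapPairs, boolSign]

lemma radSum_sub_le {ι : Type*} [Finite ι] [Nonempty ι] {n : ℕ} (b c : ι → Fin n → ℝ) :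
    radSum (fun j i => b j i - c j i) ≤ radSum b + radSum c := by
  have hneg : radSum c = ∑ ε : Fin n → Bool, ⨆ j, ∑ i, -boolSign (ε i) * c j i := by
    unfold radSum
    rw [← Equiv.sum_comp (Equiv.arrowCongr (Equiv.refl (Fin n)) Equiv.boolNot)]
    simp [boolSign_not]
  rw [hneg]
  unfold radSum
  rw [← Finset.sum_add_distrib]
  refine Finset.sum_le_sum fun ε _ => ciSup_le fun j => ?_
  calc _ = ∑ i, boolSign (ε i) * b j i + ∑ i, -boolSign (ε i) * c j i := by
        rw [← Finset.sum_add_distrib]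
        exact Finset.sum_congr rfl fun i _ => by ring
    _ ≤ _ := add_le_add (le_ciSup_finite (fun j => ∑ i, boolSign (ε i) * b j i) j)
        (le_ciSup_finite (fun j => ∑ i, -boolSign (ε i) * c j i) j)

/-- Symmetrization: the expected uniform deviation is at most twice the Rademacher average. -/
lemma integral_iSup_deviation_le {Z ι : Type*} [MeasurableSpace Z] [Finite ι] [Nonempty ι]
    (ν : Measure Z) [IsProbabilityMeasure ν] {n : ℕ} (hn : 0 < n) (h : ι → Z → ℝ)
    (hm : ∀ j, Measurable (h j)) (h1 : ∀ j z, |h j z| ≤ 1) {B : ℝ}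
    (hB : ∀ᵐ z ∂(Measure.pi fun _ : Fin n => ν), radSum (fun j i => h j (z i)) ≤ 2 ^ n * B) :
    ∫ z, ⨆ j, (∫ w, h j w ∂ν - 1 / n * ∑ i, h j (z i)) ∂(Measure.pi fun _ : Fin n => ν)
      ≤ 2 * B / n := by
  have hn' : (0 : ℝ) < n := by exact_mod_cast hn
  set P : Measure (Fin n → Z) := Measure.pi fun _ => ν with hP
  set PP : Measure (Fin n → Z × Z) := Measure.pi fun _ => ν.prod ν with hPP
  set e := MeasurableEquiv.arrowProdEquivProdArrow Z Z (Fin n) with he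
  have mp : MeasurePreserving e PP (P.prod P) :=
    measurePreserving_arrowProdEquivProdArrow Z Z (Fin n) (fun _ => ν) (fun _ => ν)
  set S : (Fin n → Z × Z) → ℝ := fun p => ⨆ j, ∑ i, (h j (p i).2 - h j (p i).1) with hS
  have hSm : Measurable S := Measurable.iSup fun j =>
    Finset.measurable_sum _ fun i _ => by
      have := hm j
      fun_prop
  have hSb : ∀ p, |S p| ≤ n * 2 := fun p => abs_ciSup_le_of_abs_le fun j =>
    abs_sum_fin_le fun i => (abs_sub _ _).trans (by linarith [h1 j (p i).2, h1 j (p i).1])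
  have hSe : Measurable fun q : (Fin n → Z) × (Fin n → Z) => S (e.symm q) :=
    hSm.comp e.symm.measurable
  have hdev : ∀ z : Fin n → Z, ⨆ j, (∫ w, h j w ∂ν - 1 / n * ∑ i, h j (z i)) ≤
      1 / n * ∫ z', S (e.symm (z, z')) ∂P := by
    intro z
    refine ciSup_le fun j => ?_
    have hi : ∀ i, ∫ z' : Fin n → Z, h j (z' i) ∂P = ∫ w, h j w ∂ν := fun i =>
      integral_comp_eval (μ := fun _ : Fin n => ν) (hm j).aestronglyMeasurable
    have hji : ∀ i, Integrable (fun z' : Fin n → Z => h j (z' i)) P := fun i =>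
      integrable_of_abs_le ((hm j).comp (measurable_pi_apply i)) fun z' => h1 j _
    have hji2 : ∀ i, Integrable (fun z' : Fin n → Z => h j (z' i) - h j (z i)) P :=
      fun i => (hji i).sub (integrable_const _)
    have e1 : ∫ w, h j w ∂ν - 1 / n * ∑ i, h j (z i) =
        1 / n * ∫ z', ∑ i, (h j (z' i) - h j (z i)) ∂P := by
      rw [integral_finsetSum _ fun i _ => hji2 i]
      simp only [integral_sub (hji _) (integrable_const _), hi]
      simp
      field_simp
    rw [e1]
    refine mul_le_mul_of_nonneg_left ?_ (by positivity)
    refine integral_mono (integrable_finsetSum _ fun i _ => hji2 i)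
      (integrable_of_abs_le (hSe.comp measurable_prodMk_left) fun _ => hSb _) fun z' => ?_
    exact le_ciSup_finite (fun j => ∑ i, (h j (z' i) - h j (z i))) j
  have hGm : Measurable fun z : Fin n → Z => ⨆ j, (∫ w, h j w ∂ν - 1 / n * ∑ i, h j (z i)) :=
    Measurable.iSup fun j => measurable_const.sub (measurable_const.mul
      (Finset.measurable_sum _ fun i _ => (hm j).comp (measurable_pi_apply i)))
  have hGb : ∀ z : Fin n → Z, |⨆ j, (∫ w, h j w ∂ν - 1 / n * ∑ i, h j (z i))| ≤ 2 := by
    intro z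
    refine abs_ciSup_le_of_abs_le fun j => (abs_sub _ _).trans ?_
    have a1 : |∫ w, h j w ∂ν| ≤ 1 := abs_integral_le_of_abs_le (h1 j)
    have a2 := abs_sum_fin_le (fun i => h1 j (z i))
    rw [abs_mul, abs_of_pos (by positivity : (0 : ℝ) < 1 / n)]
    have : 1 / (n : ℝ) * |∑ i, h j (z i)| ≤ 1 / n * (n * 1) := by gcongr
    rw [show 1 / (n : ℝ) * (n * 1) = 1 by field_simp] at this
    linarith
  have hstep : ∫ z, ⨆ j, (∫ w, h j w ∂ν - 1 / n * ∑ i, h j (z i)) ∂P ≤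
      1 / n * ∫ p, S p ∂PP := by
    calc _ ≤ ∫ z, 1 / n * ∫ z', S (e.symm (z, z')) ∂P ∂P := by
          refine integral_mono (integrable_of_abs_le hGm hGb) ?_ hdev
          exact (integrable_of_abs_le (hSe.stronglyMeasurable.integral_prod_right').measurable
            fun z => abs_integral_le_of_abs_le fun z' => hSb _).const_mul _
      _ = 1 / n * ∫ q, S (e.symm q) ∂(P.prod P) := by
          rw [integral_const_mul, integral_prod _ (integrable_of_abs_le hSe fun _ => hSb _)]
      _ = _ := by
          rw [← mp.integral_comp']
          simp
  have hswap : ∀ ε : Fin n → Bool, ∫ p, S (swapPairs ε p) ∂PP = ∫ p, S p ∂PP := fun ε => by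
    have hmp := measurePreserving_swapPairs ν (n := n) ε
    have := integral_map (μ := PP) hmp.measurable.aemeasurable (f := S)
      (hSm.aestronglyMeasurable)
    rw [← this, hmp.map_eq]
  have hSsm : ∀ ε : Fin n → Bool, Integrable (fun p => S (swapPairs ε p)) PP := fun ε =>
    integrable_of_abs_le (hSm.comp (measurePreserving_swapPairs ν ε).measurable) fun _ => hSb _
  have hmain : 2 ^ n * ∫ p, S p ∂PP ≤ 2 ^ n * (2 * B) := by
    have e1 : 2 ^ n * ∫ p, S p ∂PP = ∫ p, ∑ ε : Fin n → Bool, S (swapPairs ε p) ∂PP := by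
      rw [integral_finsetSum _ fun ε _ => hSsm ε]
      simp [hswap]
    rw [e1]
    have h1ae : ∀ᵐ p ∂PP, radSum (fun j i => h j (p i).1) ≤ 2 ^ n * B :=
      (measurePreserving_fst.comp mp).quasiMeasurePreserving.ae hB
    have h2ae : ∀ᵐ p ∂PP, radSum (fun j i => h j (p i).2) ≤ 2 ^ n * B :=
      (measurePreserving_snd.comp mp).quasiMeasurePreserving.ae hB
    have hle : ∫ p, ∑ ε : Fin n → Bool, S (swapPairs ε p) ∂PP ≤ ∫ _p, 2 ^ n * (2 * B) ∂PP := by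
      refine integral_mono_ae (integrable_finsetSum _ fun ε _ => hSsm ε) (integrable_const _) ?_
      filter_upwards [h1ae, h2ae] with p hp1 hp2
      have := radSum_sub_le (fun j i => h j (p i).2) (fun j i => h j (p i).1)
      have e2 : ∑ ε : Fin n → Bool, S (swapPairs ε p) =
          radSum (fun j i => h j (p i).2 - h j (p i).1) := by
        refine Finset.sum_congr rfl fun ε _ => ?_
        rw [hS]
        simp only [sum_swapPairs]
      rw [e2]
      linarith
    simpa using hle
  have h2 := le_of_mul_le_mul_left hmain (by positivity)
  calc _ ≤ _ := hstep
    _ ≤ 1 / n * (2 * B) := by gcongr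
    _ = _ := by ring

/-- One-sided uniform deviation bound over a finite class, with high probability. -/
lemma measure_deviation_ge_le {Z ι : Type*} [MeasurableSpace Z] [Finite ι] [Nonempty ι]
    (ν : Measure Z) [IsProbabilityMeasure ν] {n : ℕ} (hn : 0 < n) (h : ι → Z → ℝ)
    (hm : ∀ j, Measurable (h j)) (h1 : ∀ j z, h j z ∈ Set.Icc (-1) 0) {B t : ℝ} (ht : 0 ≤ t)
    (hB : ∀ᵐ z ∂(Measure.pi fun _ : Fin n => ν), radSum (fun j i => h j (z i)) ≤ 2 ^ n * B) :
    (Measure.pi fun _ : Fin n => ν)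
      {z | ∃ j, 2 * B / n + t ≤ ∫ w, h j w ∂ν - 1 / n * ∑ i, h j (z i)} ≤
      ENNReal.ofReal (exp (-(n * t ^ 2 / 2))) := by
  have hn' : (0 : ℝ) < n := by exact_mod_cast hn
  have habs : ∀ j z, |h j z| ≤ 1 := fun j z => abs_le.2 ⟨(h1 j z).1, (h1 j z).2.trans zero_le_one⟩
  set G : (Fin n → Z) → ℝ := fun z => ⨆ j, (∫ w, h j w ∂ν - 1 / n * ∑ i, h j (z i)) with hG
  have hGm : Measurable G := Measurable.iSup fun j => measurable_const.sub (measurable_const.mul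
      (Finset.measurable_sum _ fun i _ => (hm j).comp (measurable_pi_apply i)))
  have hGb : ∀ z : Fin n → Z, |G z| ≤ 2 := by
    intro z
    refine abs_ciSup_le_of_abs_le fun j => (abs_sub _ _).trans ?_
    have a1 : |∫ w, h j w ∂ν| ≤ 1 := abs_integral_le_of_abs_le (habs j)
    have a2 := abs_sum_fin_le (fun i => habs j (z i))
    rw [abs_mul, abs_of_pos (by positivity : (0 : ℝ) < 1 / n)]
    have : 1 / (n : ℝ) * |∑ i, h j (z i)| ≤ 1 / n * (n * 1) := by gcongr
    rw [show 1 / (n : ℝ) * (n * 1) = 1 by field_simp] at this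
    linarith
  have hone : ∀ z z' : Fin n → Z, ∀ i, (∀ l, l ≠ i → z l = z' l) → G z ≤ G z' + 1 / n := by
    intro z z' i hzz
    refine ciSup_le fun j => ?_
    refine le_trans ?_ (add_le_add_left (le_ciSup_finite
      (fun j => ∫ w, h j w ∂ν - 1 / n * ∑ i, h j (z' i)) j) _)
    have : ∑ l, h j (z' l) - ∑ l, h j (z l) ≤ 1 := by
      rw [← Finset.sum_sub_distrib, Finset.sum_eq_single i]
      · linarith [(h1 j (z' i)).2, (h1 j (z i)).1]
      · intro l _ hl
        rw [hzz l hl, sub_self]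
      · simp
    have : 1 / (n : ℝ) * (∑ l, h j (z' l) - ∑ l, h j (z l)) ≤ 1 / n * 1 := by gcongr
    linarith
  have hc : ∀ z i w, |G (Function.update z i w) - G z| ≤ 1 / n := by
    intro z i w
    have a1 := hone (Function.update z i w) z i fun l hl => Function.update_of_ne hl _ _
    have a2 := hone z (Function.update z i w) i fun l hl => (Function.update_of_ne hl _ _).symm
    rw [abs_le]
    constructor <;> linarith
  refine le_trans (measure_mono ?_) (measure_pi_ge_le_of_bounded_diff ν hn G hGm hGb hc ht
    (integral_iSup_deviation_le ν hn h hm habs hB))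
  rintro z ⟨j, hj⟩
  exact hj.trans (le_ciSup_finite (fun j => ∫ w, h j w ∂ν - 1 / n * ∑ i, h j (z i)) j)

lemma le_of_lipschitz_deriv_right {f f' : ℝ → ℝ} {L a b : ℝ}
    (hf : ∀ x, HasDerivAt f (f' x) x) (hL : ∀ x, |f' x - f' a| ≤ L * |x - a|) (hab : a ≤ b) :
    f b ≤ f a + f' a * (b - a) + L / 2 * (b - a) ^ 2 := by
  have hH : ∀ u, HasDerivAt (fun u => f u - f' a * (u - a) - L / 2 * (u - a) ^ 2)
      (f' u - f' a - L * (u - a)) u := fun u => by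
    have h1 := (hasDerivAt_id u).sub_const a
    have := ((hf u).sub (h1.const_mul (f' a))).sub ((h1.pow 2).const_mul (L / 2))
    refine this.congr_deriv ?_
    norm_num
    ring
  have hanti : AntitoneOn (fun u => f u - f' a * (u - a) - L / 2 * (u - a) ^ 2) (Set.Ici a) := by
    refine antitoneOn_of_deriv_nonpos (convex_Ici a)
      (fun u _ => (hH u).continuousAt.continuousWithinAt)
      (fun u _ => (hH u).differentiableAt.differentiableWithinAt) fun u hu => ?_
    rw [interior_Ici, Set.mem_Ioi] at hu
    rw [(hH u).deriv]
    have := (abs_le.1 (hL u)).2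
    rw [abs_of_pos (sub_pos.2 hu)] at this
    linarith
  have := hanti (Set.mem_Ici.2 le_rfl) (Set.mem_Ici.2 hab) hab
  simp at this
  linarith

/-- Quadratic upper bound for a function with Lipschitz derivative. -/
lemma le_of_lipschitz_deriv {f f' : ℝ → ℝ} {L a : ℝ} (b : ℝ)
    (hf : ∀ x, HasDerivAt f (f' x) x) (hL : ∀ x, |f' x - f' a| ≤ L * |x - a|) :
    f b ≤ f a + f' a * (b - a) + L / 2 * (b - a) ^ 2 := by
  rcases le_total a b with h | h
  · exact le_of_lipschitz_deriv_right hf hL h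
  · have hg : ∀ x, HasDerivAt (fun x => f (-x)) (-f' (-x)) x := fun x => by
      have := (hf (-x)).comp x (hasDerivAt_neg x)
      exact this.congr_deriv (by ring)
    have := le_of_lipschitz_deriv_right (f := fun x => f (-x)) (f' := fun x => -f' (-x))
      (L := L) (a := -a) (b := -b) hg (fun x => by
        have := hL (-x)
        simp only [neg_neg]
        rw [← abs_neg, ← abs_neg (x - -a)]
        convert this using 2 <;> ring_nf) (neg_le_neg h)
    simp only [neg_neg] at this
    linarith

lemma abs_sub_sub_le_of_lipschitz_deriv {f f' : ℝ → ℝ} {L a : ℝ} (b : ℝ)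
    (hf : ∀ x, HasDerivAt f (f' x) x) (hL : ∀ x, |f' x - f' a| ≤ L * |x - a|) :
    |f b - f a - f' a * (b - a)| ≤ L / 2 * (b - a) ^ 2 := by
  have h1 := le_of_lipschitz_deriv b hf hL
  have h2 := le_of_lipschitz_deriv (f := fun x => -f x) (f' := fun x => -f' x) b
    (fun x => (hf x).neg) (fun x => by rw [← abs_neg]; convert hL x using 2; ring)
  rw [abs_le]
  constructor <;> linarith

lemma hasDerivAt_log_one_add_exp_neg (z : ℝ) :
    HasDerivAt (fun z => log (1 + exp (-z))) (-(1 / (1 + exp z))) z := by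
  have h1 : HasDerivAt (fun z : ℝ => 1 + exp (-z)) (-exp (-z)) z := by
    simpa using ((hasDerivAt_neg z).exp).const_add 1
  convert h1.log (by positivity) using 1
  rw [exp_neg]
  field_simp
  ring

lemma abs_inv_one_add_exp_sub_le (z w : ℝ) :
    |1 / (1 + exp z) - 1 / (1 + exp w)| ≤ 1 / 4 * |z - w| := by
  have hd : ∀ z : ℝ, HasDerivAt (fun z => 1 / (1 + exp z)) (-(exp z) / (1 + exp z) ^ 2) z :=
    fun z => by
      simp only [one_div]
      exact ((Real.hasDerivAt_exp z).const_add 1).inv (by positivity)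
  refine abs_sub_le_of_abs_deriv_le (f := fun z => 1 / (1 + exp z))
    (fun z => (hd z).differentiableAt) (fun z => ?_) z w
  rw [(hd z).deriv, neg_div, abs_neg, abs_of_pos (by positivity), div_le_div_iff₀ (by positivity)
    (by norm_num)]
  nlinarith [sq_nonneg (exp z - 1)]

lemma log_one_add_exp_neg_le (z w : ℝ) :
    log (1 + exp (-w)) ≤ log (1 + exp (-z)) - 1 / (1 + exp z) * (w - z) + 1 / 8 * (w - z) ^ 2 := by
  have := le_of_lipschitz_deriv (L := 1 / 4) (a := z) w hasDerivAt_log_one_add_exp_neg (fun x => by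
    rw [← abs_neg]
    convert abs_inv_one_add_exp_sub_le x z using 2
    ring)
  linarith

/-- Quadratic upper bound for the logistic loss with labels `±1`. -/
lemma logistic_le {y : ℝ} (hy : y = 1 ∨ y = -1) (z w : ℝ) :
    log (1 + exp (-y * w)) ≤
      log (1 + exp (-y * z)) + -y / (1 + exp (y * z)) * (w - z) + 1 / 8 * (w - z) ^ 2 := by
  have h := log_one_add_exp_neg_le (y * z) (y * w)
  have hy2 : y ^ 2 = 1 := by rcases hy with rfl | rfl <;> norm_num
  have e : (y * w - y * z) ^ 2 = (w - z) ^ 2 := by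
    rw [← mul_sub, mul_pow, hy2, one_mul]
  rw [e] at h
  rw [← neg_mul, ← neg_mul] at h
  convert h using 2
  ring

section Smoothness

variable {d m n : ℕ} {β : ℝ} {σ : ℝ → ℝ} {a : Fin m → ℝ} {K₁ K₂ : ℝ}
  {x : Fin n → EuclideanSpace ℝ (Fin d)} {y : Fin n → ℝ}

lemma abs_inner_le_norm {E : Type*} [NormedAddCommGroup E] [InnerProductSpace ℝ E] (v : E) {x : E}
    (hx : ‖x‖ ≤ 1) : |⟪v, x⟫| ≤ ‖v‖ :=
  (abs_real_inner_le_norm v x).trans (mul_le_of_le_one_right (norm_nonneg v) hx)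

lemma sq_sum_norm_le_mul_nsq (Δ : Fin m → EuclideanSpace ℝ (Fin d)) :
    (∑ r, ‖Δ r‖) ^ 2 ≤ m * nsq d m Δ := by
  simpa [nsq] using sq_sum_le_card_mul_sum_sq (s := Finset.univ) (f := fun r => ‖Δ r‖)

lemma abs_fnet_sub_linear_le (hσ : ContDiff ℝ 2 σ) (hK₂ : ∀ z, |deriv (deriv σ) z| ≤ K₂)
    (ha : ∀ r, |a r| = 1) (Θ Θ' : Fin m → EuclideanSpace ℝ (Fin d))
    {x : EuclideanSpace ℝ (Fin d)} (hx : ‖x‖ ≤ 1) :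
    |fnet d m β σ a Θ' x - fnet d m β σ a Θ x -
      (m : ℝ) ^ (-β) * ∑ r, a r * (deriv σ ⟪Θ r, x⟫ * ⟪Θ' r - Θ r, x⟫)| ≤
      (m : ℝ) ^ (-β) * (K₂ / 2 * nsq d m fun r => Θ' r - Θ r) := by
  have hp : 0 ≤ (m : ℝ) ^ (-β) := by positivity
  have hK0 : 0 ≤ K₂ := (abs_nonneg _).trans (hK₂ 0)
  have hd := (hσ.differentiable (by norm_num))
  rw [fnet, fnet, ← mul_sub, ← mul_sub, ← Finset.sum_sub_distrib, ← Finset.sum_sub_distrib,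
    abs_mul, abs_of_nonneg hp]
  refine mul_le_mul_of_nonneg_left ?_ hp
  rw [nsq, Finset.mul_sum]
  refine (Finset.abs_sum_le_sum_abs _ _).trans (Finset.sum_le_sum fun r _ => ?_)
  have h1 := abs_sub_sub_le_of_lipschitz_deriv (f := σ) (f' := deriv σ) (L := K₂)
    (a := ⟪Θ r, x⟫) ⟪Θ' r, x⟫ (fun z => (hd z).hasDerivAt)
    (fun z => abs_sub_le_of_abs_deriv_le hσ.differentiable_deriv_two' hK₂ z _)
  rw [← mul_sub, ← mul_sub, abs_mul, ha r, one_mul, inner_sub_left]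
  refine h1.trans (mul_le_mul_of_nonneg_left ?_ (by positivity))
  rw [← inner_sub_left, ← sq_abs]
  gcongr
  exact abs_inner_le_norm _ hx

lemma abs_fnet_sub_le (hσ : ContDiff ℝ 2 σ) (hK₁ : ∀ z, |deriv σ z| ≤ K₁)
    (ha : ∀ r, |a r| = 1) (Θ Θ' : Fin m → EuclideanSpace ℝ (Fin d))
    {x : EuclideanSpace ℝ (Fin d)} (hx : ‖x‖ ≤ 1) :
    |fnet d m β σ a Θ' x - fnet d m β σ a Θ x| ≤
      (m : ℝ) ^ (-β) * (K₁ * ∑ r, ‖Θ' r - Θ r‖) := by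
  have hp : 0 ≤ (m : ℝ) ^ (-β) := by positivity
  have hK0 : 0 ≤ K₁ := (abs_nonneg _).trans (hK₁ 0)
  rw [fnet, fnet, ← mul_sub, ← Finset.sum_sub_distrib, abs_mul, abs_of_nonneg hp]
  refine mul_le_mul_of_nonneg_left ?_ hp
  rw [Finset.mul_sum]
  refine (Finset.abs_sum_le_sum_abs _ _).trans (Finset.sum_le_sum fun r _ => ?_)
  rw [← mul_sub, abs_mul, ha r, one_mul]
  refine (abs_sub_le_of_abs_deriv_le (hσ.differentiable (by norm_num)) hK₁ _ _).trans ?_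
  refine mul_le_mul_of_nonneg_left ?_ hK0
  rw [← inner_sub_left]
  exact abs_inner_le_norm _ hx

lemma abs_gval_le_one (hy : ∀ i, y i = 1 ∨ y i = -1) (Θ : Fin m → EuclideanSpace ℝ (Fin d))
    (i : Fin n) : |gval d m n β σ a x y Θ i| ≤ 1 := by
  have hy1 : |y i| = 1 := by rcases hy i with h | h <;> simp [h]
  rw [gval, abs_div, abs_neg, hy1, abs_of_pos (by positivity), div_le_one (by positivity)]
  linarith [exp_pos (y i * fnet d m β σ a Θ (x i))]

lemma inner_gradL (Θ : Fin m → EuclideanSpace ℝ (Fin d)) (r : Fin m)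
    (w : EuclideanSpace ℝ (Fin d)) :
    ⟪gradL d m n β σ a x y Θ r, w⟫ = 1 / n * ∑ i, gval d m n β σ a x y Θ i *
      ((m : ℝ) ^ (-β) * (a r * (deriv σ ⟪Θ r, x i⟫ * ⟪w, x i⟫))) := by
  rw [gradL, real_inner_smul_left, sum_inner]
  congr 1
  refine Finset.sum_congr rfl fun i _ => ?_
  rw [real_inner_smul_left, real_inner_comm w]
  ring

lemma sum_inner_gradL (Θ Δ : Fin m → EuclideanSpace ℝ (Fin d)) :
    ∑ r, ⟪gradL d m n β σ a x y Θ r, Δ r⟫ = 1 / n * ∑ i, gval d m n β σ a x y Θ i *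
      ((m : ℝ) ^ (-β) * ∑ r, a r * (deriv σ ⟪Θ r, x i⟫ * ⟪Δ r, x i⟫)) := by
  simp only [inner_gradL, ← Finset.mul_sum]
  rw [Finset.sum_comm]
  simp only [← Finset.mul_sum]

/-- Quadratic upper bound for the empirical loss. -/
lemma eloss_le (hn : 0 < n) (hσ : ContDiff ℝ 2 σ) (hK₁ : ∀ z, |deriv σ z| ≤ K₁)
    (hK₂ : ∀ z, |deriv (deriv σ) z| ≤ K₂) (ha : ∀ r, |a r| = 1) (hx : ∀ i, ‖x i‖ ≤ 1)
    (hy : ∀ i, y i = 1 ∨ y i = -1) (Θ Θ' : Fin m → EuclideanSpace ℝ (Fin d)) :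
    eloss d m n β σ a x y Θ' ≤ eloss d m n β σ a x y Θ +
      ∑ r, ⟪gradL d m n β σ a x y Θ r, Θ' r - Θ r⟫ +
      ((m : ℝ) ^ (-β) * K₂ / 2 + ((m : ℝ) ^ (-β)) ^ 2 * K₁ ^ 2 * m / 8) *
        nsq d m fun r => Θ' r - Θ r := by
  have hn' : (0 : ℝ) < n := by exact_mod_cast hn
  have hp : 0 ≤ (m : ℝ) ^ (-β) := by positivity
  have hK0 : 0 ≤ K₁ := (abs_nonneg _).trans (hK₁ 0)
  set N := nsq d m fun r => Θ' r - Θ r with hN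
  rw [sum_inner_gradL, eloss, eloss]
  set c := (m : ℝ) ^ (-β) * K₂ / 2 + ((m : ℝ) ^ (-β)) ^ 2 * K₁ ^ 2 * m / 8
  have e : c * N = 1 / n * ∑ _i : Fin n, c * N := by
    simp
    field_simp
  rw [e, ← mul_add, ← mul_add, ← Finset.sum_add_distrib, ← Finset.sum_add_distrib]
  refine mul_le_mul_of_nonneg_left (Finset.sum_le_sum fun i _ => ?_) (by positivity)
  have h1 := logistic_le (hy i) (fnet d m β σ a Θ (x i)) (fnet d m β σ a Θ' (x i))
  have h2 := abs_fnet_sub_linear_le (β := β) hσ hK₂ ha Θ Θ' (hx i)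
  have h3 := abs_fnet_sub_le (β := β) hσ hK₁ ha Θ Θ' (hx i)
  set l := (m : ℝ) ^ (-β) * ∑ r, a r * (deriv σ ⟪Θ r, x i⟫ * ⟪Θ' r - Θ r, x i⟫)
  set D := fnet d m β σ a Θ' (x i) - fnet d m β σ a Θ (x i)
  have h4 : gval d m n β σ a x y Θ i * (D - l) ≤ (m : ℝ) ^ (-β) * (K₂ / 2 * N) := by
    refine (le_abs_self _).trans ?_
    rw [abs_mul]
    exact (mul_le_of_le_one_left (abs_nonneg _) (abs_gval_le_one hy Θ i)).trans h2
  have h5 : D ^ 2 ≤ ((m : ℝ) ^ (-β)) ^ 2 * K₁ ^ 2 * (m * N) := by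
    calc D ^ 2 ≤ ((m : ℝ) ^ (-β) * (K₁ * ∑ r, ‖Θ' r - Θ r‖)) ^ 2 := by
          rw [← sq_abs]; gcongr
      _ = ((m : ℝ) ^ (-β)) ^ 2 * K₁ ^ 2 * (∑ r, ‖Θ' r - Θ r‖) ^ 2 := by ring
      _ ≤ _ := by gcongr; exact sq_sum_norm_le_mul_nsq _
  have e2 : -y i / (1 + exp (y i * fnet d m β σ a Θ (x i))) = gval d m n β σ a x y Θ i := rfl
  rw [e2] at h1
  have e3 : c * N = (m : ℝ) ^ (-β) * (K₂ / 2 * N) +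
    1 / 8 * (((m : ℝ) ^ (-β)) ^ 2 * K₁ ^ 2 * (m * N)) := by ring
  rw [e3]
  linarith

end Smoothness

section GradientDescent

variable {d m n : ℕ} {β : ℝ} {σ : ℝ → ℝ} {a : Fin m → ℝ} {K₁ K₂ : ℝ}
  {x : Fin n → EuclideanSpace ℝ (Fin d)} {y : Fin n → ℝ} {η : ℝ}
  {Θ₀ : Fin m → EuclideanSpace ℝ (Fin d)}

lemma nsq_nonneg (Δ : Fin m → EuclideanSpace ℝ (Fin d)) : 0 ≤ nsq d m Δ :=
  Finset.sum_nonneg fun _ _ => by positivity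

lemma eloss_nonneg (Θ : Fin m → EuclideanSpace ℝ (Fin d)) : 0 ≤ eloss d m n β σ a x y Θ := by
  refine mul_nonneg (by positivity) (Finset.sum_nonneg fun i _ => Real.log_nonneg ?_)
  linarith [exp_pos (-y i * fnet d m β σ a Θ (x i))]

lemma eloss_of_fnet_eq_zero (hn : 0 < n) {Θ : Fin m → EuclideanSpace ℝ (Fin d)}
    (h : ∀ i, fnet d m β σ a Θ (x i) = 0) : eloss d m n β σ a x y Θ = log 2 := by
  have hn' : (n : ℝ) ≠ 0 := by exact_mod_cast hn.ne'
  simp only [eloss, h]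
  norm_num
  field_simp

/-- Gradient descent with a small step size decreases the empirical loss. -/
lemma eloss_gdSeq_succ_le (hn : 0 < n) (hσ : ContDiff ℝ 2 σ) (hK₁ : ∀ z, |deriv σ z| ≤ K₁)
    (hK₂ : ∀ z, |deriv (deriv σ) z| ≤ K₂) (ha : ∀ r, |a r| = 1) (hx : ∀ i, ‖x i‖ ≤ 1)
    (hy : ∀ i, y i = 1 ∨ y i = -1) (hη : 0 < η)
    (hstep : η * ((m : ℝ) ^ (-β) * K₂ / 2 + ((m : ℝ) ^ (-β)) ^ 2 * K₁ ^ 2 * m / 8) ≤ 3 / 4)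
    (t : ℕ) :
    eloss d m n β σ a x y (gdSeq d m n β σ a x y η Θ₀ (t + 1)) ≤
      eloss d m n β σ a x y (gdSeq d m n β σ a x y η Θ₀ t) -
      η / 4 * nsq d m (gradL d m n β σ a x y (gdSeq d m n β σ a x y η Θ₀ t)) := by
  set Θ := gdSeq d m n β σ a x y η Θ₀ t with hΘ
  have h := eloss_le (β := β) hn hσ hK₁ hK₂ ha hx hy Θ (gdSeq d m n β σ a x y η Θ₀ (t + 1))
  have e : ∀ r, gdSeq d m n β σ a x y η Θ₀ (t + 1) r - Θ r =
      -(η • gradL d m n β σ a x y Θ r) := fun r => by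
    exact sub_sub_cancel_left _ _
  have e1 : ∑ r, ⟪gradL d m n β σ a x y Θ r, gdSeq d m n β σ a x y η Θ₀ (t + 1) r - Θ r⟫ =
      -(η * nsq d m (gradL d m n β σ a x y Θ)) := by
    simp only [e, inner_neg_right, real_inner_smul_right, real_inner_self_eq_norm_sq, nsq,
      Finset.sum_neg_distrib, ← Finset.mul_sum]
  have e2 : (nsq d m fun r => gdSeq d m n β σ a x y η Θ₀ (t + 1) r - Θ r) =
      η ^ 2 * nsq d m (gradL d m n β σ a x y Θ) := by
    simp only [e, nsq, norm_neg, norm_smul, mul_pow, ← Finset.mul_sum, norm_eq_abs, sq_abs]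
  rw [e1, e2] at h
  have h0 := nsq_nonneg (gradL d m n β σ a x y Θ)
  have := mul_le_mul_of_nonneg_right hstep (mul_nonneg hη.le h0)
  linarith

/-- The squared gradient norms along gradient descent are summable with a uniform bound. -/
lemma sum_nsq_gradL_le (hn : 0 < n) (hσ : ContDiff ℝ 2 σ) (hK₁ : ∀ z, |deriv σ z| ≤ K₁)
    (hK₂ : ∀ z, |deriv (deriv σ) z| ≤ K₂) (ha : ∀ r, |a r| = 1) (hx : ∀ i, ‖x i‖ ≤ 1)
    (hy : ∀ i, y i = 1 ∨ y i = -1) (hη : 0 < η)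
    (hstep : η * ((m : ℝ) ^ (-β) * K₂ / 2 + ((m : ℝ) ^ (-β)) ^ 2 * K₁ ^ 2 * m / 8) ≤ 3 / 4)
    (h0 : ∀ i, fnet d m β σ a Θ₀ (x i) = 0) (t : ℕ) :
    η * ∑ s ∈ range t, nsq d m (gradL d m n β σ a x y (gdSeq d m n β σ a x y η Θ₀ s)) ≤
      4 * log 2 := by
  have key : ∀ t, eloss d m n β σ a x y (gdSeq d m n β σ a x y η Θ₀ t) + η / 4 *
      ∑ s ∈ range t, nsq d m (gradL d m n β σ a x y (gdSeq d m n β σ a x y η Θ₀ s)) ≤ log 2 := by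
    intro t
    induction t with
    | zero => simp [gdSeq, eloss_of_fnet_eq_zero hn h0]
    | succ t ih =>
      rw [Finset.sum_range_succ, mul_add]
      linarith [eloss_gdSeq_succ_le (Θ₀ := Θ₀) hn hσ hK₁ hK₂ ha hx hy hη hstep t]
  linarith [key t, eloss_nonneg (β := β) (σ := σ) (a := a) (x := x) (y := y)
    (gdSeq d m n β σ a x y η Θ₀ t)]

lemma gdSeq_sub_init (t : ℕ) (r : Fin m) :
    gdSeq d m n β σ a x y η Θ₀ t r - Θ₀ r =
      -(η • ∑ s ∈ range t, gradL d m n β σ a x y (gdSeq d m n β σ a x y η Θ₀ s) r) := by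
  induction t with
  | zero => simp [gdSeq]
  | succ t ih =>
    rw [Finset.sum_range_succ, smul_add, neg_add, ← ih, gdSeq, sub_right_comm, sub_eq_add_neg]

lemma nsq_gdSeq_sub_init_le (hη : 0 < η) (t : ℕ) :
    (nsq d m fun r => gdSeq d m n β σ a x y η Θ₀ t r - Θ₀ r) ≤
      η * t * (η * ∑ s ∈ range t, nsq d m
        (gradL d m n β σ a x y (gdSeq d m n β σ a x y η Θ₀ s))) := by
  simp only [nsq, gdSeq_sub_init, norm_neg, norm_smul, mul_pow, norm_eq_abs, sq_abs]
  rw [Finset.sum_comm, ← mul_assoc, Finset.mul_sum]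
  refine Finset.sum_le_sum fun r _ => ?_
  set g := fun s => gradL d m n β σ a x y (gdSeq d m n β σ a x y η Θ₀ s) r
  have h1 : ‖∑ s ∈ range t, g s‖ ^ 2 ≤ t * ∑ s ∈ range t, ‖g s‖ ^ 2 := by
    calc _ ≤ (∑ s ∈ range t, ‖g s‖) ^ 2 := by gcongr; exact norm_sum_le _ _
      _ ≤ _ := by simpa using sq_sum_le_card_mul_sum_sq (s := range t) (f := fun s => ‖g s‖)
  calc _ ≤ η ^ 2 * (t * ∑ s ∈ range t, ‖g s‖ ^ 2) := by gcongr
    _ = _ := by ring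

lemma norm_gradL_le (hK₁ : ∀ z, |deriv σ z| ≤ K₁) (ha : ∀ r, |a r| = 1) (hx : ∀ i, ‖x i‖ ≤ 1)
    (Θ : Fin m → EuclideanSpace ℝ (Fin d)) (r : Fin m) :
    ‖gradL d m n β σ a x y Θ r‖ ≤ (m : ℝ) ^ (-β) * K₁ * L1norm d m n β σ a x y Θ := by
  have hp : 0 ≤ (m : ℝ) ^ (-β) := by positivity
  have hK0 : 0 ≤ K₁ := (abs_nonneg _).trans (hK₁ 0)
  rw [gradL, norm_smul, L1norm, norm_of_nonneg (by positivity), mul_left_comm, Finset.mul_sum]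
  refine mul_le_mul_of_nonneg_left ((norm_sum_le _ _).trans
    (Finset.sum_le_sum fun i _ => ?_)) (by positivity)
  rw [norm_smul, norm_mul, norm_mul, norm_mul, norm_eq_abs, norm_eq_abs, norm_eq_abs, norm_eq_abs,
    ha r, one_mul, abs_of_nonneg hp]
  calc _ ≤ |gval d m n β σ a x y Θ i| * ((m : ℝ) ^ (-β) * K₁) * 1 := by
        gcongr
        · exact hK₁ _
        · exact hx i
    _ = _ := by ring

lemma L1norm_nonneg (Θ : Fin m → EuclideanSpace ℝ (Fin d)) :
    0 ≤ L1norm d m n β σ a x y Θ :=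
  mul_nonneg (by positivity) (Finset.sum_nonneg fun _ _ => abs_nonneg _)

/-- Gradient domination in the neighbourhood of a separating initialization. -/
lemma L1norm_sq_le_nsq_gradL (hσ : ContDiff ℝ 2 σ) (hK₂ : ∀ z, |deriv (deriv σ) z| ≤ K₂)
    (ha : ∀ r, |a r| = 1) (hx : ∀ i, ‖x i‖ ≤ 1)
    (hy : ∀ i, y i = 1 ∨ y i = -1) (hm : 0 < m) {ρ : ℝ} (hρ : 0 < ρ)
    {w : Fin m → EuclideanSpace ℝ (Fin d)} (hw : ∀ r, ‖w r‖ ≤ 1)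
    (hsep : ∀ i, m * ρ / 2 ≤ y i * ∑ r, deriv σ ⟪Θ₀ r, x i⟫ * ⟪x i, w r⟫)
    {Θ : Fin m → EuclideanSpace ℝ (Fin d)}
    (hΘ : K₂ ^ 2 * (nsq d m fun r => Θ r - Θ₀ r) ≤ m * ρ ^ 2 / 8) :
    m * ((m : ℝ) ^ (-β)) ^ 2 * ρ ^ 2 / 64 * L1norm d m n β σ a x y Θ ^ 2 ≤
      nsq d m (gradL d m n β σ a x y Θ) := by
  have hp : 0 ≤ (m : ℝ) ^ (-β) := by positivity
  have hm' : (0 : ℝ) < m := by exact_mod_cast hm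
  have hK0 : 0 ≤ K₂ := (abs_nonneg _).trans (hK₂ 0)
  have hs : K₂ * ∑ r, ‖Θ r - Θ₀ r‖ ≤ 3 / 8 * (m * ρ) := by
    refine abs_le_of_sq_le_sq' ?_ (by positivity) |>.2
    calc (K₂ * ∑ r, ‖Θ r - Θ₀ r‖) ^ 2 = K₂ ^ 2 * (∑ r, ‖Θ r - Θ₀ r‖) ^ 2 := by ring
      _ ≤ K₂ ^ 2 * (m * nsq d m fun r => Θ r - Θ₀ r) := by
          gcongr; exact sq_sum_norm_le_mul_nsq _
      _ = m * (K₂ ^ 2 * nsq d m fun r => Θ r - Θ₀ r) := by ring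
      _ ≤ m * (m * ρ ^ 2 / 8) := by gcongr
      _ ≤ (3 / 8 * (m * ρ)) ^ 2 := by nlinarith [sq_nonneg (m * ρ)]
  have hdd := hσ.differentiable_deriv_two'
  have hsep' : ∀ i, m * ρ / 8 ≤ y i * ∑ r, deriv σ ⟪Θ r, x i⟫ * ⟪w r, x i⟫ := by
    intro i
    have hy1 : |y i| = 1 := by rcases hy i with h | h <;> simp [h]
    have h1 : |y i * ∑ r, deriv σ ⟪Θ r, x i⟫ * ⟪w r, x i⟫ -
        y i * ∑ r, deriv σ ⟪Θ₀ r, x i⟫ * ⟪x i, w r⟫| ≤ K₂ * ∑ r, ‖Θ r - Θ₀ r‖ := by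
      rw [← mul_sub, abs_mul, hy1, one_mul, ← Finset.sum_sub_distrib, Finset.mul_sum]
      refine (Finset.abs_sum_le_sum_abs _ _).trans (Finset.sum_le_sum fun r _ => ?_)
      rw [real_inner_comm (w r), ← sub_mul, abs_mul]
      have h2 := abs_sub_le_of_abs_deriv_le hdd hK₂ ⟪Θ r, x i⟫ ⟪Θ₀ r, x i⟫
      rw [← inner_sub_left] at h2
      calc _ ≤ (K₂ * ‖Θ r - Θ₀ r‖) * 1 := by
            refine mul_le_mul (h2.trans ?_) ?_ (abs_nonneg _) (by positivity)
            · gcongr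
              exact abs_inner_le_norm _ (hx i)
            · exact (abs_inner_le_norm _ (hx i)).trans (hw r)
        _ = _ := mul_one _
    have h3 := hsep i
    have h4 := (abs_le.1 h1).1
    linarith
  have hmul : ∀ i, |gval d m n β σ a x y Θ i| * (m * ρ / 8) ≤
      -(gval d m n β σ a x y Θ i) * ∑ r, deriv σ ⟪Θ r, x i⟫ * ⟪w r, x i⟫ := by
    intro i
    have hy1 : |y i| = 1 := by rcases hy i with h | h <;> simp [h]
    have e1 : |gval d m n β σ a x y Θ i| = 1 / (1 + exp (y i * fnet d m β σ a Θ (x i))) := by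
      rw [gval, abs_div, abs_neg, hy1, abs_of_pos (by positivity)]
    have e2 : -(gval d m n β σ a x y Θ i) =
      1 / (1 + exp (y i * fnet d m β σ a Θ (x i))) * y i := by rw [gval]; ring
    rw [e1, e2, mul_assoc]
    gcongr
    exact hsep' i
  have hlow : (m : ℝ) ^ (-β) * (m * ρ / 8) * L1norm d m n β σ a x y Θ ≤
      ∑ r, ⟪gradL d m n β σ a x y Θ r, -(a r) • w r⟫ := by
    have ha2 : ∀ r, a r * a r = 1 := fun r => by rw [← abs_mul_abs_self, ha r, one_mul]
    rw [sum_inner_gradL, L1norm, mul_left_comm, Finset.mul_sum]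
    refine mul_le_mul_of_nonneg_left (Finset.sum_le_sum fun i _ => ?_) (by positivity)
    have e : ∑ r, a r * (deriv σ ⟪Θ r, x i⟫ * ⟪-(a r) • w r, x i⟫) =
        -∑ r, deriv σ ⟪Θ r, x i⟫ * ⟪w r, x i⟫ := by
      rw [← Finset.sum_neg_distrib]
      refine Finset.sum_congr rfl fun r _ => ?_
      rw [real_inner_smul_left]
      linear_combination (-deriv σ ⟪Θ r, x i⟫ * ⟪w r, x i⟫) * ha2 r
    rw [e]
    have := mul_le_mul_of_nonneg_left (hmul i) hp
    linarith
  have hup : ∑ r, ⟪gradL d m n β σ a x y Θ r, -(a r) • w r⟫ ≤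
      ∑ r, ‖gradL d m n β σ a x y Θ r‖ := by
    refine Finset.sum_le_sum fun r _ => (le_abs_self _).trans (abs_inner_le_norm _ ?_)
    rw [norm_smul, norm_neg, norm_eq_abs, ha r, one_mul]
    exact hw r
  have h0 := L1norm_nonneg (β := β) (σ := σ) (a := a) (x := x) (y := y) Θ
  have hsq := pow_le_pow_left₀ (by positivity) (hlow.trans hup) 2
  have hfin := hsq.trans (sq_sum_norm_le_mul_nsq (gradL d m n β σ a x y Θ))
  refine le_of_mul_le_mul_left ?_ hm'
  refine le_trans (le_of_eq ?_) hfin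
  ring

/-- Behaviour of gradient descent from a separating initialization: the iterates stay close to
the initialization and some iterate has a small functional gradient. -/
lemma gdSeq_convergence (hn : 0 < n) (hσ : ContDiff ℝ 2 σ) (hK₁ : ∀ z, |deriv σ z| ≤ K₁)
    (hK₂ : ∀ z, |deriv (deriv σ) z| ≤ K₂) (hK₁0 : 0 < K₁) (hK₂0 : 0 < K₂)
    (ha : ∀ r, |a r| = 1) (hx : ∀ i, ‖x i‖ ≤ 1)
    (hy : ∀ i, y i = 1 ∨ y i = -1) (hη : 0 < η)
    (hstep : η * ((m : ℝ) ^ (-β) * K₂ / 2 + ((m : ℝ) ^ (-β)) ^ 2 * K₁ ^ 2 * m / 8) ≤ 3 / 4)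
    (h0 : ∀ i, fnet d m β σ a Θ₀ (x i) = 0) (hm : 0 < m) {ρ : ℝ} (hρ : 0 < ρ)
    {w : Fin m → EuclideanSpace ℝ (Fin d)} (hw : ∀ r, ‖w r‖ ≤ 1)
    (hsep : ∀ i, m * ρ / 2 ≤ y i * ∑ r, deriv σ ⟪Θ₀ r, x i⟫ * ⟪x i, w r⟫)
    {T : ℕ} (hT0 : 0 < T) (hT : K₂ ^ 2 * (4 * log 2 * (η * T)) ≤ m * ρ ^ 2 / 8) :
    (∀ t < T, (nsq d m fun r => gdSeq d m n β σ a x y η Θ₀ t r - Θ₀ r) ≤ 4 * log 2 * (η * T) ∧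
      ∀ r, ‖gdSeq d m n β σ a x y η Θ₀ t r - Θ₀ r‖ ≤ 3 * K₁ / K₂) ∧
    ∃ t < T, η * T * m * ((m : ℝ) ^ (-β)) ^ 2 * ρ ^ 2 *
      L1norm d m n β σ a x y (gdSeq d m n β σ a x y η Θ₀ t) ^ 2 ≤ 256 * log 2 := by
  have hm' : (0 : ℝ) < m := by exact_mod_cast hm
  have hp : 0 < (m : ℝ) ^ (-β) := by positivity
  set Θ := gdSeq d m n β σ a x y η Θ₀ with hΘ
  set G : ℕ → ℝ := fun t => L1norm d m n β σ a x y (Θ t) with hG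
  set N : ℕ → ℝ := fun t => nsq d m (gradL d m n β σ a x y (Θ t)) with hN
  have hlog : 0 < log 2 := Real.log_pos one_lt_two
  have hsum : ∀ t, η * ∑ s ∈ range t, N s ≤ 4 * log 2 :=
    sum_nsq_gradL_le hn hσ hK₁ hK₂ ha hx hy hη hstep h0
  have hdisp : ∀ t ≤ T, (nsq d m fun r => Θ t r - Θ₀ r) ≤ 4 * log 2 * (η * T) := by
    intro t ht
    have ht' : (t : ℝ) ≤ T := by exact_mod_cast ht
    calc _ ≤ η * t * (η * ∑ s ∈ range t, N s) := nsq_gdSeq_sub_init_le hη t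
      _ ≤ η * t * (4 * log 2) := by exact mul_le_mul_of_nonneg_left (hsum t) (by positivity)
      _ ≤ η * T * (4 * log 2) := by gcongr
      _ = _ := by ring
  have hdom : ∀ t < T, m * ((m : ℝ) ^ (-β)) ^ 2 * ρ ^ 2 / 64 * G t ^ 2 ≤ N t := fun t ht =>
    L1norm_sq_le_nsq_gradL hσ hK₂ ha hx hy hm hρ hw hsep
      ((mul_le_mul_of_nonneg_left (hdisp t ht.le) (by positivity)).trans hT)
  have hGsum : ∀ t ≤ T, η * (m * ((m : ℝ) ^ (-β)) ^ 2 * ρ ^ 2) * ∑ s ∈ range t, G s ^ 2 ≤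
      256 * log 2 := by
    intro t ht
    have h1 : ∑ s ∈ range t, m * ((m : ℝ) ^ (-β)) ^ 2 * ρ ^ 2 / 64 * G s ^ 2 ≤
        ∑ s ∈ range t, N s :=
      Finset.sum_le_sum fun s hs => hdom s ((Finset.mem_range.1 hs).trans_le ht)
    rw [← Finset.mul_sum] at h1
    have := (mul_le_mul_of_nonneg_left h1 hη.le).trans (hsum t)
    linarith
  refine ⟨fun t ht => ⟨hdisp t ht.le, fun r => ?_⟩, ?_⟩
  · have h1 : ‖Θ t r - Θ₀ r‖ ≤ η * ((m : ℝ) ^ (-β) * K₁ * ∑ s ∈ range t, G s) := by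
      rw [hΘ, gdSeq_sub_init, norm_neg, norm_smul, norm_of_nonneg hη.le, Finset.mul_sum]
      gcongr
      exact (norm_sum_le _ _).trans (Finset.sum_le_sum fun s _ => norm_gradL_le hK₁ ha hx _ r)
    have h2 : (∑ s ∈ range t, G s) ^ 2 ≤ t * ∑ s ∈ range t, G s ^ 2 := by
      simpa using sq_sum_le_card_mul_sum_sq (s := range t) (f := G)
    have ht' : (t : ℝ) ≤ T := by exact_mod_cast ht.le
    have h3 : (K₂ * ‖Θ t r - Θ₀ r‖) ^ 2 * (m * ρ ^ 2) ≤ (3 * K₁) ^ 2 * (m * ρ ^ 2) := by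
      calc (K₂ * ‖Θ t r - Θ₀ r‖) ^ 2 * (m * ρ ^ 2)
          ≤ (K₂ * (η * ((m : ℝ) ^ (-β) * K₁ * ∑ s ∈ range t, G s))) ^ 2 * (m * ρ ^ 2) := by
            gcongr
        _ = K₂ ^ 2 * K₁ ^ 2 * η * (η * (m * ((m : ℝ) ^ (-β)) ^ 2 * ρ ^ 2)) *
            (∑ s ∈ range t, G s) ^ 2 := by ring
        _ ≤ K₂ ^ 2 * K₁ ^ 2 * η * (η * (m * ((m : ℝ) ^ (-β)) ^ 2 * ρ ^ 2)) *
            (t * ∑ s ∈ range t, G s ^ 2) := by gcongr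
        _ = K₂ ^ 2 * K₁ ^ 2 * η * t * (η * (m * ((m : ℝ) ^ (-β)) ^ 2 * ρ ^ 2) *
            ∑ s ∈ range t, G s ^ 2) := by ring
        _ ≤ K₂ ^ 2 * K₁ ^ 2 * η * T * (256 * log 2) := by
            exact mul_le_mul (by gcongr) (hGsum t ht.le)
              (by positivity) (by positivity)
        _ = 64 * K₁ ^ 2 * (K₂ ^ 2 * (4 * log 2 * (η * T))) := by ring
        _ ≤ 64 * K₁ ^ 2 * (m * ρ ^ 2 / 8) := by gcongr
        _ ≤ _ := by nlinarith [mul_pos (pow_pos hK₁0 2) (mul_pos hm' (pow_pos hρ 2))]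
    have h4 := le_of_mul_le_mul_right h3 (by positivity)
    rw [le_div_iff₀ hK₂0, mul_comm]
    exact (abs_le_of_sq_le_sq' h4 (by positivity)).2
  · by_contra! hcon
    have h1 : ∑ s ∈ range T, 256 * log 2 < ∑ s ∈ range T,
        η * T * m * ((m : ℝ) ^ (-β)) ^ 2 * ρ ^ 2 * G s ^ 2 :=
      Finset.sum_lt_sum_of_nonempty (Finset.nonempty_range_iff.2 hT0.ne')
        fun s hs => hcon s (Finset.mem_range.1 hs)
    rw [Finset.sum_const, Finset.card_range, nsmul_eq_mul, ← Finset.mul_sum] at h1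
    have h2 := mul_le_mul_of_nonneg_left (hGsum T le_rfl) (Nat.cast_nonneg (α := ℝ) T)
    refine absurd h1 (not_lt.2 ((Eq.le ?_).trans (h2.trans (Eq.le ?_)))) <;> ring

end GradientDescent

section RampLoss

variable {γ : ℝ}

lemma ramp_eq_max_min (hγ : 0 < γ) (v : ℝ) : ramp γ v = max 0 (min 1 (1 - v / γ)) := by
  rw [ramp]
  split_ifs with h1 h2
  · have : v / γ < 0 := div_neg_of_neg_of_pos h1 hγ
    rw [min_eq_left (by linarith), max_eq_right zero_le_one]
  · have h3 : 0 ≤ v / γ := div_nonneg (not_lt.1 h1) hγ.le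
    have h4 : v / γ ≤ 1 := (div_le_one hγ).2 h2
    rw [min_eq_right (by linarith), max_eq_right (by linarith)]
  · have h3 : 1 < v / γ := (one_lt_div hγ).2 (not_le.1 h2)
    rw [max_eq_left (min_le_of_right_le (by linarith))]

lemma ramp_nonneg (hγ : 0 < γ) (v : ℝ) : 0 ≤ ramp γ v := by
  rw [ramp_eq_max_min hγ]; exact le_max_left _ _

lemma ramp_le_one (hγ : 0 < γ) (v : ℝ) : ramp γ v ≤ 1 := by
  rw [ramp_eq_max_min hγ]; exact max_le zero_le_one (min_le_left _ _)

lemma ramp_of_nonpos (hγ : 0 < γ) {v : ℝ} (hv : v ≤ 0) : ramp γ v = 1 := by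
  rw [ramp_eq_max_min hγ, min_eq_left, max_eq_right zero_le_one]
  linarith [div_nonpos_of_nonpos_of_nonneg hv hγ.le]

lemma abs_ramp_sub_le (hγ : 0 < γ) (v w : ℝ) : |ramp γ v - ramp γ w| ≤ |v - w| / γ := by
  rw [ramp_eq_max_min hγ, ramp_eq_max_min hγ]
  refine (abs_max_sub_max_le_max _ _ _ _).trans ?_
  rw [sub_self, abs_zero]
  refine max_le (by positivity) ((abs_min_sub_min_le_max _ _ _ _).trans ?_)
  rw [sub_self, abs_zero]
  refine max_le (by positivity) (le_of_eq ?_)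
  rw [sub_sub_sub_cancel_left, ← sub_div, abs_div, abs_of_pos hγ, abs_sub_comm]

lemma continuous_ramp (hγ : 0 < γ) : Continuous (ramp γ) := by
  rw [show ramp γ = fun v => max 0 (min 1 (1 - v / γ)) from funext (ramp_eq_max_min hγ)]
  fun_prop

lemma ramp_le_logistic (hγ : 0 < γ) (v : ℝ) : ramp γ v ≤ (1 + exp γ) * (1 / (1 + exp v)) := by
  rw [mul_one_div]
  by_cases h : v ≤ γ
  · refine (ramp_le_one hγ v).trans ?_
    rw [one_le_div (by positivity)]
    gcongr
  · rw [ramp, if_neg (by linarith), if_neg h]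
    positivity

end RampLoss

section RampClass

variable {d m n : ℕ} {β γ : ℝ} {σ : ℝ → ℝ} {a : Fin m → ℝ} {K₁ K₂ : ℝ}
  {x : Fin n → EuclideanSpace ℝ (Fin d)} {y : Fin n → ℝ}

lemma sum_ramp_le_L1norm (hγ : 0 < γ) (hy : ∀ i, y i = 1 ∨ y i = -1)
    (Θ : Fin m → EuclideanSpace ℝ (Fin d)) :
    1 / n * ∑ i, ramp γ (y i * fnet d m β σ a Θ (x i)) ≤
      (1 + exp γ) * L1norm d m n β σ a x y Θ := by
  rw [L1norm, mul_left_comm, Finset.mul_sum _ _ (1 + exp γ)]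
  refine mul_le_mul_of_nonneg_left (Finset.sum_le_sum fun i _ => ?_) (by positivity)
  have hy1 : |y i| = 1 := by rcases hy i with h | h <;> simp [h]
  have hpos : 0 < 1 + exp (y i * fnet d m β σ a Θ (x i)) := by positivity
  rw [gval, abs_div, abs_neg, hy1, abs_of_pos hpos]
  exact ramp_le_logistic hγ _

/-- Rademacher bound for the ramp losses of networks near a vanishing initialization. -/
lemma radSq_ramp_le {ι : Type*} [Finite ι] [Nonempty ι] (hγ : 0 < γ) (hσ : ContDiff ℝ 2 σ)
    (hK₁ : ∀ z, |deriv σ z| ≤ K₁) (hK₂ : ∀ z, |deriv (deriv σ) z| ≤ K₂)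
    (h1 : 0 < K₁) (h2 : 0 < K₂) (ha : ∀ r, |a r| = 1) {Θ : Fin m → EuclideanSpace ℝ (Fin d)}
    (h0 : ∀ i, fnet d m β σ a Θ (x i) = 0)
    (Δ : ι → Fin m → EuclideanSpace ℝ (Fin d)) (hΔ : ∀ j r, ‖Δ j r‖ ≤ 3 * K₁ / K₂) {D : ℝ}
    (hD : ∀ j, nsq d m (Δ j) ≤ D) (hx : ∀ i, ‖x i‖ ≤ 1) (hy : ∀ i, y i = 1 ∨ y i = -1) :
    radSq (fun j i => ramp γ (y i * fnet d m β σ a (Θ + Δ j) (x i)) - 1) ≤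
      ((m : ℝ) ^ (-β) / γ) ^ 2 * (D * (m * (2 ^ n * n * (30 * K₁) ^ 2))) := by
  have hp : 0 ≤ (m : ℝ) ^ (-β) / γ := by positivity
  have hy1 : ∀ i, |y i| = 1 := fun i => by rcases hy i with h | h <;> simp [h]
  set N : ι → Fin n → ℝ := fun j i => ∑ r, a r * (σ ⟪Θ r + Δ j r, x i⟫ - σ ⟪Θ r, x i⟫) with hN
  have hf : ∀ j i, fnet d m β σ a (Θ + Δ j) (x i) = (m : ℝ) ^ (-β) * N j i := fun j i => by
    rw [← sub_zero (fnet d m β σ a (Θ + Δ j) (x i)), ← h0 i, fnet, fnet, ← mul_sub,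
      ← Finset.sum_sub_distrib]
    simp only [hN, mul_sub, Pi.add_apply]
  have hlip : ∀ (i : Fin n) (u w : ℝ), |ramp γ (y i * u) - ramp γ (y i * w)| ≤ |u - w| / γ :=
    fun i u w => by
      refine (abs_ramp_sub_le hγ _ _).trans (le_of_eq ?_)
      rw [← mul_sub, abs_mul, hy1, one_mul]
  calc _ ≤ radSq (fun j i => (m : ℝ) ^ (-β) / γ * N j i) := by
        refine radSq_contraction _ _ (fun j j' i => ?_) fun j i => ?_
        · rw [sub_sub_sub_cancel_right]
          refine (hlip i _ _).trans (le_of_eq ?_)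
          rw [hf, hf, ← mul_sub, ← mul_sub, abs_mul, abs_mul, abs_of_nonneg hp,
            abs_of_nonneg (a := (m : ℝ) ^ (-β)) (by positivity)]
          ring
        · have := hlip i (fnet d m β σ a (Θ + Δ j) (x i)) 0
          rw [mul_zero, ramp_of_nonpos hγ le_rfl, sub_zero] at this
          refine this.trans (le_of_eq ?_)
          rw [hf, abs_mul, abs_mul, abs_of_nonneg hp,
            abs_of_nonneg (a := (m : ℝ) ^ (-β)) (by positivity)]
          ring
    _ = ((m : ℝ) ^ (-β) / γ) ^ 2 * radSq N := radSq_mul _ hp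
    _ ≤ _ := by
        gcongr
        exact radSq_network_le hσ hK₁ hK₂ h1 h2 ha Θ Δ x hΔ hD hx

/-- Generalization gap of the ramp loss. -/
def rampGap (d m n : ℕ) (β γ : ℝ) (σ : ℝ → ℝ) (a : Fin m → ℝ)
    (ν : Measure (EuclideanSpace ℝ (Fin d) × ℝ)) (Θ : Fin m → EuclideanSpace ℝ (Fin d))
    (z : Fin n → EuclideanSpace ℝ (Fin d) × ℝ) : ℝ :=
  ∫ q, ramp γ (q.2 * fnet d m β σ a Θ q.1) ∂ν -
    1 / n * ∑ i, ramp γ ((z i).2 * fnet d m β σ a Θ (z i).1)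

lemma continuous_ramp_fnet (hγ : 0 < γ) (hσ : Continuous σ) :
    Continuous fun q : (Fin m → EuclideanSpace ℝ (Fin d)) × (EuclideanSpace ℝ (Fin d) × ℝ) =>
      ramp γ (q.2.2 * fnet d m β σ a q.1 q.2.1) := by
  have := continuous_ramp hγ
  unfold fnet
  fun_prop

variable {ν : Measure (EuclideanSpace ℝ (Fin d) × ℝ)} [IsProbabilityMeasure ν]

lemma abs_ramp_le_one (hγ : 0 < γ) (v : ℝ) : |ramp γ v| ≤ 1 :=
  abs_le.2 ⟨by linarith [ramp_nonneg hγ v], ramp_le_one hγ v⟩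

lemma continuous_rampGap (hγ : 0 < γ) (hσ : Continuous σ) :
    Continuous fun q : (Fin m → EuclideanSpace ℝ (Fin d)) ×
      (Fin n → EuclideanSpace ℝ (Fin d) × ℝ) => rampGap d m n β γ σ a ν q.1 q.2 := by
  have hc := continuous_ramp_fnet (d := d) (β := β) (a := a) hγ hσ
  have h1 : Continuous fun Θ : Fin m → EuclideanSpace ℝ (Fin d) =>
      ∫ q, ramp γ (q.2 * fnet d m β σ a Θ q.1) ∂ν := by
    refine continuous_of_dominated (bound := fun _ => 1) (fun Θ => ?_) (fun Θ => ?_)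
      (integrable_const _) ?_
    · exact (hc.comp (Continuous.prodMk_right Θ)).aestronglyMeasurable
    · exact Filter.Eventually.of_forall fun q => abs_ramp_le_one hγ _
    · exact Filter.Eventually.of_forall fun q => hc.comp (Continuous.prodMk_left q)
  unfold rampGap
  refine (h1.comp continuous_fst).sub (continuous_const.mul (continuous_finsetSum _ fun i _ => ?_))
  exact hc.comp (continuous_fst.prodMk ((continuous_apply i).comp continuous_snd))

/-- Uniform deviation bound for a sequence of networks near a vanishing initialization. -/
lemma measure_rampGap_ge_le (hγ : 0 < γ) (hσ : ContDiff ℝ 2 σ)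
    (hK₁ : ∀ z, |deriv σ z| ≤ K₁) (hK₂ : ∀ z, |deriv (deriv σ) z| ≤ K₂)
    (h1 : 0 < K₁) (h2 : 0 < K₂) (ha : ∀ r, |a r| = 1) {Θ : Fin m → EuclideanSpace ℝ (Fin d)}
    (h0 : ∀ x, fnet d m β σ a Θ x = 0) (hn : 0 < n)
    (hν : ∀ᵐ q ∂ν, ‖q.1‖ ≤ 1 ∧ (q.2 = 1 ∨ q.2 = -1))
    (Δ : ℕ → Fin m → EuclideanSpace ℝ (Fin d)) (hΔ : ∀ j r, ‖Δ j r‖ ≤ 3 * K₁ / K₂) {D t : ℝ}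
    (hD0 : 0 ≤ D) (hD : ∀ j, nsq d m (Δ j) ≤ D) (ht : 0 ≤ t) :
    (Measure.pi fun _ : Fin n => ν) {z | ∃ j, 60 * K₁ * (m : ℝ) ^ (-β) * √m * √D / (γ * √n) + t ≤
      rampGap d m n β γ σ a ν (Θ + Δ j) z} ≤ ENNReal.ofReal (exp (-(n * t ^ 2 / 2))) := by
  have hn' : (0 : ℝ) < n := by exact_mod_cast hn
  set V : ℝ := (m : ℝ) ^ (-β) / γ * √D * √m * √n * (30 * K₁) with hV
  have hVn : 2 * V / n = 60 * K₁ * (m : ℝ) ^ (-β) * √m * √D / (γ * √n) := by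
    have : (n : ℝ) = √n * √n := (Real.mul_self_sqrt hn'.le).symm
    have hs : 0 < √(n : ℝ) := Real.sqrt_pos.2 hn'
    rw [hV, div_eq_div_iff hn'.ne' (by positivity)]
    field_simp
    linear_combination (-60 : ℝ) * √D * √m * (m : ℝ) ^ (-β) * this
  have hae : ∀ᵐ z ∂(Measure.pi fun _ : Fin n => ν),
      ∀ i, ‖(z i).1‖ ≤ 1 ∧ ((z i).2 = 1 ∨ (z i).2 = -1) :=
    ae_all_iff.2 fun i => (Measure.quasiMeasurePreserving_eval (fun _ : Fin n => ν) i).ae hν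
  have hc := continuous_ramp_fnet (d := d) (β := β) (a := a) hγ hσ.continuous
  set A : ℕ → Set (Fin n → EuclideanSpace ℝ (Fin d) × ℝ) := fun N =>
    {z | ∃ j : Fin (N + 1), 2 * V / n + t ≤ rampGap d m n β γ σ a ν (Θ + Δ j) z} with hA
  have hfin : ∀ N, (Measure.pi fun _ : Fin n => ν) (A N) ≤
      ENNReal.ofReal (exp (-(n * t ^ 2 / 2))) := by
    intro N
    have hmeas : ∀ j : Fin (N + 1), Measurable fun q : EuclideanSpace ℝ (Fin d) × ℝ =>
        ramp γ (q.2 * fnet d m β σ a (Θ + Δ j) q.1) := fun j =>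
      (hc.comp (Continuous.prodMk_right (Θ + Δ j))).measurable
    have := measure_deviation_ge_le ν hn
      (fun (j : Fin (N + 1)) q => ramp γ (q.2 * fnet d m β σ a (Θ + Δ j) q.1) - 1)
      (fun j => (hmeas j).sub_const 1)
      (fun j q => ⟨by linarith [ramp_nonneg hγ (q.2 * fnet d m β σ a (Θ + Δ j) q.1)],
        by linarith [ramp_le_one hγ (q.2 * fnet d m β σ a (Θ + Δ j) q.1)]⟩) (B := V) ht (by
        filter_upwards [hae] with z hz
        refine radSum_le_of_radSq_le _ (by positivity) ?_
        refine (radSq_ramp_le hγ hσ hK₁ hK₂ h1 h2 ha (fun i => h0 (z i).1)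
          (fun j : Fin (N + 1) => Δ j) (fun j => hΔ j) (fun j => hD j) (fun i => (hz i).1)
          (fun i => (hz i).2)).trans (le_of_eq ?_)
        rw [hV]
        simp only [mul_pow, Real.sq_sqrt hD0, Real.sq_sqrt (Nat.cast_nonneg (α := ℝ) _)]
        ring)
    refine le_trans (measure_mono ?_) this
    rintro z ⟨j, hj⟩
    refine ⟨j, hj.trans (le_of_eq ?_)⟩
    rw [rampGap, integral_sub (integrable_of_abs_le (hmeas j) fun _ => abs_ramp_le_one hγ _)
      (integrable_const _), Finset.sum_sub_distrib]
    simp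
    field_simp
    ring
  have hmono : Monotone A := by
    intro N N' hN z
    rintro ⟨j, hj⟩
    exact ⟨Fin.castLE (by omega) j, hj⟩
  have hU : {z | ∃ j, 60 * K₁ * (m : ℝ) ^ (-β) * √m * √D / (γ * √n) + t ≤
      rampGap d m n β γ σ a ν (Θ + Δ j) z} = ⋃ N, A N := by
    ext z
    simp only [hA, Set.mem_iUnion, Set.mem_ofPred_eq, ← hVn]
    constructor
    · rintro ⟨j, hj⟩
      exact ⟨j, ⟨j, by omega⟩, hj⟩
    · rintro ⟨N, j, hj⟩
      exact ⟨j, hj⟩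
  rw [hU, hmono.measure_iUnion]
  exact iSup_le hfin

/-- A closeness class of parameters admits a countable dense family. -/
lemma exists_dense_seq_displacement {D R : ℝ} (hD : 0 ≤ D) (hR : 0 ≤ R) :
    ∃ Δ : ℕ → Fin m → EuclideanSpace ℝ (Fin d), (∀ j r, ‖Δ j r‖ ≤ R) ∧ (∀ j, nsq d m (Δ j) ≤ D) ∧
      ∀ w : Fin m → EuclideanSpace ℝ (Fin d), (∀ r, ‖w r‖ ≤ R) → nsq d m w ≤ D →
        w ∈ closure (Set.range Δ) := by
  set S : Set (Fin m → EuclideanSpace ℝ (Fin d)) := {w | (∀ r, ‖w r‖ ≤ R) ∧ nsq d m w ≤ D} with hS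
  have hne : Nonempty S := ⟨⟨0, by simp [hS, hR, nsq, hD]⟩⟩
  refine ⟨fun j => TopologicalSpace.denseSeq S j, fun j => (TopologicalSpace.denseSeq S j).2.1,
    fun j => (TopologicalSpace.denseSeq S j).2.2, fun w h1 h2 => ?_⟩
  have := (TopologicalSpace.denseRange_denseSeq S) ⟨w, h1, h2⟩
  have h3 := map_mem_closure continuous_subtype_val this (t := Set.range fun j =>
    (TopologicalSpace.denseSeq S j : Fin m → EuclideanSpace ℝ (Fin d)))
    (by rintro _ ⟨j, rfl⟩; exact ⟨j, rfl⟩)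
  exact h3

lemma rampGap_le_of_mem_closure (hγ : 0 < γ) (hσ : Continuous σ)
    {Θ w : Fin m → EuclideanSpace ℝ (Fin d)} {Δ : ℕ → Fin m → EuclideanSpace ℝ (Fin d)}
    (hw : w ∈ closure (Set.range Δ)) {z : Fin n → EuclideanSpace ℝ (Fin d) × ℝ} {c : ℝ}
    (h : ∀ j, rampGap d m n β γ σ a ν (Θ + Δ j) z ≤ c) :
    rampGap d m n β γ σ a ν (Θ + w) z ≤ c := by
  have hpair : Continuous fun w : Fin m → EuclideanSpace ℝ (Fin d) => (Θ + w, z) :=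
    (continuous_const.add continuous_id).prodMk continuous_const
  have hgap : Continuous fun q : (Fin m → EuclideanSpace ℝ (Fin d)) ×
      (Fin n → EuclideanSpace ℝ (Fin d) × ℝ) => rampGap d m n β γ σ a ν q.1 q.2 :=
    continuous_rampGap hγ hσ
  have hc : Continuous fun w : Fin m → EuclideanSpace ℝ (Fin d) =>
      rampGap d m n β γ σ a ν (Θ + w) z := by
    have := hgap.comp hpair
    simpa only [Function.comp_def] using this
  have hcl : IsClosed {w | rampGap d m n β γ σ a ν (Θ + w) z ≤ c} := isClosed_le hc continuous_const
  have hsub : Set.range Δ ⊆ {w | rampGap d m n β γ σ a ν (Θ + w) z ≤ c} := by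
    rintro _ ⟨j, rfl⟩
    exact h j
  exact closure_minimal hsub hcl hw

/-- The ramp loss dominates the misclassification probability. -/
lemma measure_misclassified_le (hγ : 0 < γ) (hσ : Continuous σ)
    (Θ : Fin m → EuclideanSpace ℝ (Fin d)) :
    (ν {q | q.2 * fnet d m β σ a Θ q.1 ≤ 0}).toReal ≤
      ∫ q, ramp γ (q.2 * fnet d m β σ a Θ q.1) ∂ν := by
  have hc := continuous_ramp_fnet (d := d) (β := β) (a := a) hγ hσ
  have hcq := hc.comp (Continuous.prodMk_right Θ)
  have hS : MeasurableSet {q : EuclideanSpace ℝ (Fin d) × ℝ | q.2 * fnet d m β σ a Θ q.1 ≤ 0} := by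
    refine measurableSet_le (Continuous.measurable ?_) measurable_const
    unfold fnet
    fun_prop
  have h1 : (ν {q | q.2 * fnet d m β σ a Θ q.1 ≤ 0}).toReal =
      ∫ q, Set.indicator {q | q.2 * fnet d m β σ a Θ q.1 ≤ 0} (fun _ => (1 : ℝ)) q ∂ν := by
    rw [integral_indicator_const _ hS]
    simp [Measure.real]
  rw [h1]
  refine integral_mono ((integrable_const _).indicator hS)
    (integrable_of_abs_le hcq.measurable fun _ => abs_ramp_le_one hγ _) fun q => ?_
  by_cases hq : q ∈ {q : EuclideanSpace ℝ (Fin d) × ℝ | q.2 * fnet d m β σ a Θ q.1 ≤ 0}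
  · rw [Set.indicator_of_mem hq]
    exact (ramp_of_nonpos hγ hq).ge
  · rw [Set.indicator_of_notMem hq]
    exact ramp_nonneg hγ _

end RampClass

section SymmetricInitialization

variable {d k : ℕ}

lemma sum_fin_two_mul {M : Type*} [AddCommMonoid M] (f : Fin (2 * k) → M) :
    ∑ r, f r = ∑ r : Fin k, f ⟨r, by omega⟩ + ∑ r : Fin k, f ⟨k + r, by omega⟩ := by
  rw [← Fin.sum_congr' f (two_mul k).symm, Fin.sum_univ_add]
  rfl

lemma symInit_left (ω : Fin k → EuclideanSpace ℝ (Fin d)) (r : Fin k) :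
    symInit d k ω ⟨r, by omega⟩ = ω r := by
  simp [symInit]

lemma symInit_right (ω : Fin k → EuclideanSpace ℝ (Fin d)) (r : Fin k) :
    symInit d k ω ⟨k + r, by omega⟩ = ω r := by
  simp [symInit]

lemma abs_symSigns (r : Fin (2 * k)) : |symSigns k r| = 1 := by
  rw [symSigns]; split_ifs <;> simp

lemma sum_symInit (ω : Fin k → EuclideanSpace ℝ (Fin d)) (F : EuclideanSpace ℝ (Fin d) → ℝ) :
    ∑ r, F (symInit d k ω r) = 2 * ∑ r, F (ω r) := by
  rw [sum_fin_two_mul]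
  simp only [symInit_left, symInit_right]
  ring

lemma fnet_symInit (β : ℝ) (σ : ℝ → ℝ) (ω : Fin k → EuclideanSpace ℝ (Fin d))
    (x : EuclideanSpace ℝ (Fin d)) :
    fnet d (2 * k) β σ (symSigns k) (symInit d k ω) x = 0 := by
  rw [fnet, sum_fin_two_mul]
  simp only [symInit_left, symInit_right]
  simp [symSigns]

lemma continuous_symInit : Continuous (symInit d k) := by
  refine continuous_pi fun r => ?_
  by_cases h : (r : ℕ) < k
  · simp only [symInit, dif_pos h]
    fun_prop
  · simp only [symInit, dif_neg h]
    fun_prop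

variable {σ : ℝ → ℝ} {K₁ ρ : ℝ} {μ₀ : Measure (EuclideanSpace ℝ (Fin d))} [IsProbabilityMeasure μ₀]
  {v : EuclideanSpace ℝ (Fin d) → EuclideanSpace ℝ (Fin d)}

lemma measurable_tangent_feature (hσ : ContDiff ℝ 2 σ) (hv : Measurable v) :
    Measurable fun q : EuclideanSpace ℝ (Fin d) × EuclideanSpace ℝ (Fin d) =>
      deriv σ ⟪q.1, q.2⟫ * ⟪q.2, v q.1⟫ :=
  ((hσ.differentiable_deriv_two'.continuous.measurable).comp
    (measurable_fst.inner measurable_snd)).mul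
    (measurable_snd.inner (hv.comp measurable_fst))

lemma abs_tangent_feature_le (hK₁ : ∀ z, |deriv σ z| ≤ K₁) (hv1 : ∀ θ, ‖v θ‖ ≤ 1)
    {x : EuclideanSpace ℝ (Fin d)} (hx : ‖x‖ ≤ 1) (θ : EuclideanSpace ℝ (Fin d)) :
    |deriv σ ⟪θ, x⟫ * ⟪x, v θ⟫| ≤ K₁ := by
  rw [abs_mul]
  have h := (abs_inner_le_norm x (hv1 θ)).trans hx
  calc _ ≤ K₁ * 1 := mul_le_mul (hK₁ _) h (abs_nonneg _) ((abs_nonneg _).trans (hK₁ 0))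
    _ = K₁ := mul_one _

lemma le_of_separable (hK₁ : ∀ z, |deriv σ z| ≤ K₁) (hv1 : ∀ θ, ‖v θ‖ ≤ 1)
    {x : EuclideanSpace ℝ (Fin d)} (hx : ‖x‖ ≤ 1) {y : ℝ} (hy : y = 1 ∨ y = -1)
    (hsep : ρ ≤ y * ∫ θ, deriv σ ⟪θ, x⟫ * ⟪x, v θ⟫ ∂μ₀) : ρ ≤ K₁ := by
  have hy1 : |y| = 1 := by rcases hy with h | h <;> simp [h]
  refine hsep.trans ((le_abs_self _).trans ?_)
  rw [abs_mul, hy1, one_mul]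
  exact abs_integral_le_of_abs_le (abs_tangent_feature_le hK₁ hv1 hx)

/-- A separable point is separated by the random tangent features with high probability. -/
lemma measure_not_separated_le (hσ : ContDiff ℝ 2 σ) (hK₁ : ∀ z, |deriv σ z| ≤ K₁) (h1 : 0 < K₁)
    (hk : 0 < k) (hρ : 0 < ρ) (hv : Measurable v) (hv1 : ∀ θ, ‖v θ‖ ≤ 1)
    {x : EuclideanSpace ℝ (Fin d)} (hx : ‖x‖ ≤ 1) {y : ℝ} (hy : y = 1 ∨ y = -1)
    (hsep : ρ ≤ y * ∫ θ, deriv σ ⟪θ, x⟫ * ⟪x, v θ⟫ ∂μ₀) :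
    (Measure.pi fun _ : Fin k => μ₀)
      {ω | y * ∑ r, deriv σ ⟪ω r, x⟫ * ⟪x, v (ω r)⟫ < k * ρ / 2} ≤
      ENNReal.ofReal (exp (-(k * ρ ^ 2 / (8 * K₁ ^ 2)))) := by
  have hk' : (0 : ℝ) < k := by exact_mod_cast hk
  have hy1 : |y| = 1 := by rcases hy with h | h <;> simp [h]
  set P := Measure.pi fun _ : Fin k => μ₀ with hP
  set X : EuclideanSpace ℝ (Fin d) → ℝ := fun θ => -(y * (deriv σ ⟪θ, x⟫ * ⟪x, v θ⟫)) with hX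
  have hXm : Measurable X := (((measurable_tangent_feature hσ hv).comp
    (measurable_id.prodMk measurable_const)).const_mul y).neg
  have hXb : ∀ θ, |X θ| ≤ K₁ := fun θ => by
    rw [hX]
    simp only [abs_neg]
    rw [abs_mul, hy1, one_mul]
    exact abs_tangent_feature_le hK₁ hv1 hx θ
  have hXi : ∫ θ, X θ ∂μ₀ ≤ -ρ := by
    rw [hX]
    simp only [integral_neg, integral_const_mul]
    linarith
  set Y : Fin k → (Fin k → EuclideanSpace ℝ (Fin d)) → ℝ :=
    fun r ω => X (ω r) - ∫ θ, X θ ∂μ₀ with hY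
  have hind : ProbabilityTheory.iIndepFun Y P :=
    ProbabilityTheory.iIndepFun_pi (μ := fun _ : Fin k => μ₀)
      (X := fun _ θ => X θ - ∫ θ, X θ ∂μ₀) fun _ => (hXm.sub_const _).aemeasurable
  have hsub : ∀ r ∈ (Finset.univ : Finset (Fin k)),
      ProbabilityTheory.HasSubgaussianMGF (Y r) ((‖K₁ - -K₁‖₊ / 2) ^ 2) P := fun r _ => by
    have := ProbabilityTheory.hasSubgaussianMGF_of_mem_Icc (μ := P) (X := fun ω => X (ω r))
      (a := -K₁) (b := K₁) (hXm.comp (measurable_pi_apply r)).aemeasurable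
      (Filter.Eventually.of_forall fun ω => abs_le.1 (hXb (ω r)))
    rw [integral_comp_eval (μ := fun _ : Fin k => μ₀) hXm.aestronglyMeasurable] at this
    exact this
  have hmain := ProbabilityTheory.HasSubgaussianMGF.measure_sum_ge_le_of_iIndepFun hind hsub
    (ε := k * ρ / 2) (by positivity)
  have hc : ((∑ _r : Fin k, (‖K₁ - -K₁‖₊ / 2) ^ 2 : NNReal) : ℝ) = k * K₁ ^ 2 := by
    push_cast
    rw [Finset.sum_const, Finset.card_univ, Fintype.card_fin, nsmul_eq_mul, norm_eq_abs,
      div_pow, sq_abs]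
    ring
  rw [hc] at hmain
  have hexp : -(k * ρ / 2) ^ 2 / (2 * (k * K₁ ^ 2)) = -(k * ρ ^ 2 / (8 * K₁ ^ 2)) := by
    field_simp
    ring
  rw [hexp] at hmain
  refine le_trans (measure_mono ?_) (ENNReal.le_ofReal_iff_toReal_le (measure_ne_top _ _)
    (exp_nonneg _) |>.2 hmain)
  intro ω hω
  rw [Set.mem_ofPred_eq] at hω ⊢
  have e : ∑ r, Y r ω = -(y * ∑ r, deriv σ ⟪ω r, x⟫ * ⟪x, v (ω r)⟫) - k * ∫ θ, X θ ∂μ₀ := by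
    simp only [hY, hX, Finset.sum_sub_distrib, Finset.sum_neg_distrib, ← Finset.mul_sum]
    simp
  rw [e]
  have := mul_le_mul_of_nonneg_left hXi hk'.le
  linarith

end SymmetricInitialization

lemma measure_prod_le_of_fiber_snd {α β : Type*} [MeasurableSpace α] [MeasurableSpace β]
    {μ : Measure α} {ν : Measure β} [IsProbabilityMeasure μ] [IsProbabilityMeasure ν]
    {s : Set (α × β)} (hs : MeasurableSet s) {c : ENNReal}
    (h : ∀ᵐ y ∂ν, μ {x | (x, y) ∈ s} ≤ c) : (μ.prod ν) s ≤ c := by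
  rw [Measure.prod_apply_symm hs]
  refine (lintegral_mono_ae h).trans ?_
  simp

lemma measure_prod_le_of_fiber_fst {α β : Type*} [MeasurableSpace α] [MeasurableSpace β]
    {μ : Measure α} {ν : Measure β} [IsProbabilityMeasure μ] [IsProbabilityMeasure ν]
    {s : Set (α × β)} (hs : MeasurableSet s) {c : ENNReal}
    (h : ∀ x, ν {y | (x, y) ∈ s} ≤ c) : (μ.prod ν) s ≤ c := by
  rw [Measure.prod_apply hs]
  refine (lintegral_mono h).trans ?_
  simp

/-- Width scalings in terms of the output scale `m ^ (-β)`. -/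
lemma rpow_scalings {M : ℝ} (hM : 0 < M) (β : ℝ) :
    M ^ (2 * β - 1) = 1 / ((M ^ (-β)) ^ 2 * M) ∧ M ^ (β - 1 / 2) = 1 / (M ^ (-β) * √M) ∧
      M ^ (1 / 2 - β) = M ^ (-β) * √M := by
  have e : (M ^ (-β)) ^ 2 = M ^ (-β * 2) := by
    rw [← Real.rpow_natCast, ← Real.rpow_mul hM.le]; norm_num
  refine ⟨?_, ?_, ?_⟩
  · rw [e, one_div, ← Real.rpow_add_one hM.ne', ← Real.rpow_neg hM.le]
    congr 1; ring
  · rw [Real.sqrt_eq_rpow, ← Real.rpow_add hM, one_div (M ^ _), ← Real.rpow_neg hM.le]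
    congr 1; ring
  · rw [Real.sqrt_eq_rpow, ← Real.rpow_add hM]
    congr 1; ring

lemma log_two_le_one : log 2 ≤ 1 := by linarith [Real.log_two_lt_d9]

/-- The step-size conditions yield the smoothness condition used for the descent estimate. -/
lemma step_size_bound {M p η ρ K₁ K₂ T : ℝ} (hM : 0 < M) (hp : 0 < p) (hη : 0 < η) (hρ : 0 < ρ)
    (hK : ρ ≤ K₁) (hK₂ : 0 < K₂) (h1 : η ≤ 4 * (1 / (p ^ 2 * M)) / (K₁ ^ 2 + K₂)) (hT1 : 1 ≤ T)
    (hT : T * (32 * η * K₂ ^ 2 * log 2) ≤ M * ρ ^ 2) :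
    η * (p * K₂ / 2 + p ^ 2 * K₁ ^ 2 * M / 8) ≤ 3 / 4 := by
  have hK₁ : 0 < K₁ := hρ.trans_le hK
  have hl := Real.log_two_gt_d9
  have h2 : η * (p ^ 2 * M) * (K₁ ^ 2 + K₂) ≤ 4 := by
    rw [le_div_iff₀ (by positivity), mul_one_div, le_div_iff₀ (by positivity)] at h1
    linarith
  have h3 : η * p ^ 2 * M * K₁ ^ 2 ≤ 4 := by
    have : 0 ≤ η * (p ^ 2 * M) * K₂ := by positivity
    linarith
  have h4 : 32 * η * K₂ ^ 2 * log 2 ≤ M * K₁ ^ 2 := by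
    calc _ ≤ T * (32 * η * K₂ ^ 2 * log 2) := le_mul_of_one_le_left (by positivity) hT1
      _ ≤ M * ρ ^ 2 := hT
      _ ≤ _ := by gcongr
  have h5 : η * p ^ 2 * (32 * η * K₂ ^ 2 * log 2) ≤ 4 :=
    (mul_le_mul_of_nonneg_left h4 (by positivity)).trans (le_trans (le_of_eq (by ring)) h3)
  have h6 : (η * p * K₂) ^ 2 ≤ (1 / 2) ^ 2 := by
    have : 0 ≤ (η * p * K₂) ^ 2 := by positivity
    nlinarith
  have h7 := (abs_le_of_sq_le_sq' h6 (by norm_num)).2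
  linarith

/-- Deterministic part of the generalization bound: on the event that the sample is separated at
initialization and the ramp gaps are uniformly controlled, gradient descent generalizes. -/
lemma exists_misclassification_le {d m n : ℕ} {β γ η ρ : ℝ} {σ : ℝ → ℝ} {a : Fin m → ℝ}
    {K₁ K₂ c Q : ℝ} {z : Fin n → EuclideanSpace ℝ (Fin d) × ℝ}
    {Θ₀ w : Fin m → EuclideanSpace ℝ (Fin d)}
    {ν : Measure (EuclideanSpace ℝ (Fin d) × ℝ)} [IsProbabilityMeasure ν]
    (hn : 0 < n) (hm : 0 < m) (hσ : ContDiff ℝ 2 σ)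
    (hK₁ : ∀ z, |deriv σ z| ≤ K₁) (hK₂ : ∀ z, |deriv (deriv σ) z| ≤ K₂) (hK₁0 : 0 < K₁)
    (hK₂0 : 0 < K₂) (ha : ∀ r, |a r| = 1) (hz : ∀ i, ‖(z i).1‖ ≤ 1)
    (hy : ∀ i, (z i).2 = 1 ∨ (z i).2 = -1) (hγ : 0 < γ) (hη : 0 < η) (hρ : 0 < ρ)
    (hstep : η * ((m : ℝ) ^ (-β) * K₂ / 2 + ((m : ℝ) ^ (-β)) ^ 2 * K₁ ^ 2 * m / 8) ≤ 3 / 4)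
    (h0 : ∀ x, fnet d m β σ a Θ₀ x = 0) (hw : ∀ r, ‖w r‖ ≤ 1)
    (hsep : ∀ i, m * ρ / 2 ≤ (z i).2 * ∑ r, deriv σ ⟪Θ₀ r, (z i).1⟫ * ⟪(z i).1, w r⟫)
    {T : ℕ} (hT0 : 0 < T) (hT : K₂ ^ 2 * (4 * log 2 * (η * T)) ≤ m * ρ ^ 2 / 8) (hQ : 0 ≤ Q)
    {Δ : ℕ → Fin m → EuclideanSpace ℝ (Fin d)}
    (hΔ : ∀ w : Fin m → EuclideanSpace ℝ (Fin d), (∀ r, ‖w r‖ ≤ 3 * K₁ / K₂) →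
      nsq d m w ≤ 4 * log 2 * (η * T) → w ∈ closure (Set.range Δ))
    (hgap : ∀ j, rampGap d m n β γ σ a ν (Θ₀ + Δ j) z ≤ c) :
    ∃ t < T, (ν {p | p.2 * fnet d m β σ a (gdSeq d m n β σ a (fun i => (z i).1)
        (fun i => (z i).2) η Θ₀ t) p.1 ≤ 0}).toReal ≤
      16 * (1 + exp γ) * (ρ⁻¹ * (T : ℝ) ^ (-(1 / 2) : ℝ) *
        ((m : ℝ) ^ (β - 1 / 2) * η ^ (-(1 / 2) : ℝ) + Q)) + c := by
  have hm' : (0 : ℝ) < m := by exact_mod_cast hm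
  have hT' : (0 : ℝ) < T := by exact_mod_cast hT0
  obtain ⟨hclose, t, ht, hG⟩ := gdSeq_convergence hn hσ hK₁ hK₂ hK₁0 hK₂0 ha hz hy hη hstep
    (fun i => h0 _) hm hρ hw hsep hT0 hT
  refine ⟨t, ht, ?_⟩
  set Θ := gdSeq d m n β σ a (fun i => (z i).1) (fun i => (z i).2) η Θ₀ t with hΘ
  set G := L1norm d m n β σ a (fun i => (z i).1) (fun i => (z i).2) Θ with hGdef
  have h1 := measure_misclassified_le (ν := ν) (β := β) (a := a) hγ hσ.continuous Θ
  have h2 : rampGap d m n β γ σ a ν Θ z ≤ c := by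
    have := rampGap_le_of_mem_closure hγ hσ.continuous
      (hΔ _ (hclose t ht).2 (hclose t ht).1) hgap
    have e : (Θ₀ + fun r => Θ r - Θ₀ r) = Θ := by
      ext1 r
      simp
    rwa [e] at this
  have h3 : 1 / n * ∑ i, ramp γ ((z i).2 * fnet d m β σ a Θ (z i).1) ≤ (1 + exp γ) * G :=
    sum_ramp_le_L1norm hγ hy Θ
  have h4 : G ≤ 16 * (ρ⁻¹ * (T : ℝ) ^ (-(1 / 2) : ℝ) *
        ((m : ℝ) ^ (β - 1 / 2) * η ^ (-(1 / 2) : ℝ))) := by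
    have hp : 0 < (m : ℝ) ^ (-β) := by positivity
    have hsq : (√η * √T * √m * (m : ℝ) ^ (-β) * ρ * G) ^ 2 ≤ 16 ^ 2 := by
      simp only [mul_pow, Real.sq_sqrt hη.le, Real.sq_sqrt hT'.le, Real.sq_sqrt hm'.le]
      exact hG.trans (by linarith [log_two_le_one])
    have h5 := (abs_le_of_sq_le_sq' hsq (by norm_num)).2
    rw [(rpow_scalings hm' β).2.1, Real.rpow_neg hT'.le, Real.rpow_neg hη.le,
      ← Real.sqrt_eq_rpow, ← Real.sqrt_eq_rpow]
    have hη2 := Real.sqrt_pos.2 hη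
    have hT2 := Real.sqrt_pos.2 hT'
    have hm2 := Real.sqrt_pos.2 hm'
    have e : 16 * (ρ⁻¹ * (√T)⁻¹ * (1 / ((m : ℝ) ^ (-β) * √m) * (√η)⁻¹)) =
        16 / (√η * √T * √m * (m : ℝ) ^ (-β) * ρ) := by
      field_simp
    rw [e, le_div_iff₀ (by positivity)]
    linarith
  have h6 : 0 ≤ ρ⁻¹ * (T : ℝ) ^ (-(1 / 2) : ℝ) * Q := by positivity
  have h7 := mul_le_mul_of_nonneg_left (h4.trans (le_add_of_nonneg_right
    (mul_nonneg (by norm_num : (0 : ℝ) ≤ 16) h6))) (by positivity : 0 ≤ 1 + exp γ)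
  rw [rampGap] at h2
  linarith

/-- With high probability over the initialization and the sample, the tangent features at
initialization separate the sample. -/
lemma measure_prod_not_separated_le {d n k : ℕ} (hk : 0 < k) (hn : 0 < n) {σ : ℝ → ℝ} {K₁ ρ δ : ℝ}
    (hσ : ContDiff ℝ 2 σ) (hK₁ : ∀ z, |deriv σ z| ≤ K₁) (hK₁0 : 0 < K₁) (hρ : 0 < ρ) (hδ : 0 < δ)
    {μ₀ : Measure (EuclideanSpace ℝ (Fin d))} [IsProbabilityMeasure μ₀]
    {ν : Measure (EuclideanSpace ℝ (Fin d) × ℝ)} [IsProbabilityMeasure ν]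
    {v : EuclideanSpace ℝ (Fin d) → EuclideanSpace ℝ (Fin d)}
    (hv : Measurable v) (hv1 : ∀ θ, ‖v θ‖ ≤ 1)
    (hsep : ∀ᵐ p ∂ν, ‖p.1‖ ≤ 1 ∧ (p.2 = 1 ∨ p.2 = -1) ∧
      ρ ≤ p.2 * ∫ θ, deriv σ ⟪θ, p.1⟫ * ⟪p.1, v θ⟫ ∂μ₀)
    (hkδ : 16 * K₁ ^ 2 / ρ ^ 2 * log (2 * n / δ) ≤ 2 * k) :
    ((Measure.pi fun _ : Fin k => μ₀).prod (Measure.pi fun _ : Fin n => ν))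
      {ω | ∃ i, (ω.2 i).2 * ∑ r, deriv σ ⟪ω.1 r, (ω.2 i).1⟫ * ⟪(ω.2 i).1, v (ω.1 r)⟫ <
        k * ρ / 2} ≤ ENNReal.ofReal (δ / 2) := by
  have hk' : (0 : ℝ) < k := by exact_mod_cast hk
  have hn' : (0 : ℝ) < n := by exact_mod_cast hn
  refine measure_prod_le_of_fiber_snd ?_ ?_
  · rw [Set.ofPred_exists]
    refine MeasurableSet.iUnion fun i => measurableSet_lt ?_ measurable_const
    have hi : Measurable fun ω : (Fin k → EuclideanSpace ℝ (Fin d)) ×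
        (Fin n → EuclideanSpace ℝ (Fin d) × ℝ) => ω.2 i :=
      (measurable_pi_apply i).comp measurable_snd
    refine hi.snd.mul (Finset.measurable_sum _ fun r _ => ?_)
    have hf : Measurable fun q : EuclideanSpace ℝ (Fin d) × EuclideanSpace ℝ (Fin d) =>
        deriv σ ⟪q.1, q.2⟫ * ⟪q.2, v q.1⟫ := measurable_tangent_feature hσ hv
    have hpair : Measurable fun ω : (Fin k → EuclideanSpace ℝ (Fin d)) ×
        (Fin n → EuclideanSpace ℝ (Fin d) × ℝ) => (ω.1 r, (ω.2 i).1) :=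
      ((measurable_pi_apply r).comp measurable_fst).prodMk hi.fst
    have := hf.comp hpair
    simpa only [Function.comp_def] using this
  have hae : ∀ᵐ z ∂(Measure.pi fun _ : Fin n => ν), ∀ i,
      ‖(z i).1‖ ≤ 1 ∧ ((z i).2 = 1 ∨ (z i).2 = -1) ∧
        ρ ≤ (z i).2 * ∫ θ, deriv σ ⟪θ, (z i).1⟫ * ⟪(z i).1, v θ⟫ ∂μ₀ :=
    ae_all_iff.2 fun i => (Measure.quasiMeasurePreserving_eval (fun _ : Fin n => ν) i).ae hsep
  filter_upwards [hae] with z hz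
  have hexp : exp (-(k * ρ ^ 2 / (8 * K₁ ^ 2))) ≤ δ / 2 / n := by
    have h1 : log (2 * n / δ) ≤ k * ρ ^ 2 / (8 * K₁ ^ 2) := by
      rw [div_mul_eq_mul_div, div_le_iff₀ (by positivity)] at hkδ
      rw [le_div_iff₀ (by positivity)]
      linarith
    calc _ ≤ exp (-log (2 * n / δ)) := by gcongr
      _ = δ / 2 / n := by
        rw [Real.exp_neg, Real.exp_log (by positivity)]
        field_simp
  simp only [Set.ofPred_exists]
  calc _ ≤ ∑ i : Fin n, ENNReal.ofReal (δ / 2 / n) := by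
        refine (measure_iUnion_fintype_le _ _).trans (Finset.sum_le_sum fun i _ => ?_)
        exact (measure_not_separated_le hσ hK₁ hK₁0 hk hρ hv hv1 (hz i).1 (hz i).2.1
          (hz i).2.2).trans (ENNReal.ofReal_le_ofReal hexp)
    _ = ENNReal.ofReal (δ / 2) := by
        rw [← ENNReal.ofReal_sum_of_nonneg fun _ _ => by positivity]
        congr 1
        simp
        field_simp

/-- With high probability over the initialization and the sample, the ramp gaps are small for all
displacements in a given sequence. -/
lemma measure_prod_rampGap_ge_le {d n k : ℕ} (hn : 0 < n) {σ : ℝ → ℝ} {K₁ K₂ β γ δ D : ℝ}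
    (hσ : ContDiff ℝ 2 σ) (hK₁ : ∀ z, |deriv σ z| ≤ K₁) (hK₂ : ∀ z, |deriv (deriv σ) z| ≤ K₂)
    (hK₁0 : 0 < K₁) (hK₂0 : 0 < K₂) (hγ : 0 < γ) (hδ : 0 < δ) (hδ1 : δ < 1) (hD : 0 ≤ D)
    {μ₀ : Measure (EuclideanSpace ℝ (Fin d))} [IsProbabilityMeasure μ₀]
    {ν : Measure (EuclideanSpace ℝ (Fin d) × ℝ)} [IsProbabilityMeasure ν]
    (hν : ∀ᵐ p ∂ν, ‖p.1‖ ≤ 1 ∧ (p.2 = 1 ∨ p.2 = -1))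
    (Δ : ℕ → Fin (2 * k) → EuclideanSpace ℝ (Fin d))
    (hΔ1 : ∀ j r, ‖Δ j r‖ ≤ 3 * K₁ / K₂) (hΔ2 : ∀ j, nsq d (2 * k) (Δ j) ≤ D) :
    ((Measure.pi fun _ : Fin k => μ₀).prod (Measure.pi fun _ : Fin n => ν))
      {ω | ∃ j, 60 * K₁ * (2 * k : ℝ) ^ (-β) * √(2 * k : ℝ) * √D / (γ * √n) +
        3 * √(log (2 / δ) / (2 * n)) ≤
          rampGap d (2 * k) n β γ σ (symSigns k) ν (symInit d k ω.1 + Δ j) ω.2} ≤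
      ENNReal.ofReal (δ / 2) := by
  have hn' : (0 : ℝ) < n := by exact_mod_cast hn
  have hL : 0 ≤ log (2 / δ) := Real.log_nonneg (by rw [le_div_iff₀ hδ]; linarith)
  refine measure_prod_le_of_fiber_fst ?_ fun ω₁ => ?_
  · rw [Set.ofPred_exists]
    refine MeasurableSet.iUnion fun j => measurableSet_le measurable_const ?_
    have hgap : Continuous fun q : (Fin (2 * k) → EuclideanSpace ℝ (Fin d)) ×
        (Fin n → EuclideanSpace ℝ (Fin d) × ℝ) =>
        rampGap d (2 * k) n β γ σ (symSigns k) ν q.1 q.2 := continuous_rampGap hγ hσ.continuous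
    have hpair : Continuous fun ω : (Fin k → EuclideanSpace ℝ (Fin d)) ×
        (Fin n → EuclideanSpace ℝ (Fin d) × ℝ) => (symInit d k ω.1 + Δ j, ω.2) :=
      ((continuous_symInit.comp continuous_fst).add continuous_const).prodMk continuous_snd
    have := (hgap.comp hpair).measurable
    simpa only [Function.comp_def] using this
  have h := measure_rampGap_ge_le (n := n) (β := β) (ν := ν) hγ hσ hK₁ hK₂ hK₁0 hK₂0
    (abs_symSigns (k := k)) (fnet_symInit β σ ω₁) hn hν Δ hΔ1 hD hΔ2
    (by positivity : 0 ≤ 3 * √(log (2 / δ) / (2 * n)))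
  rw [show ((2 * k : ℕ) : ℝ) = 2 * k by push_cast; rfl] at h
  refine h.trans (ENNReal.ofReal_le_ofReal ?_)
  have e : (n : ℝ) * (3 * √(log (2 / δ) / (2 * n))) ^ 2 / 2 = 9 / 4 * log (2 / δ) := by
    rw [mul_pow, Real.sq_sqrt (by positivity)]
    field_simp
    ring
  calc _ ≤ exp (-log (2 / δ)) := by
        rw [e]
        gcongr
        linarith
    _ = δ / 2 := by
        rw [Real.exp_neg, Real.exp_log (by positivity), inv_div]

lemma ofReal_one_sub_le_measure {Ω : Type*} [MeasurableSpace Ω] {P : Measure Ω}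
    [IsProbabilityMeasure P] {δ : ℝ} (hδ : 0 < δ) {B₁ B₂ G : Set Ω}
    (h₁ : P B₁ ≤ ENNReal.ofReal (δ / 2)) (h₂ : P B₂ ≤ ENNReal.ofReal (δ / 2))
    (hG : ∀ᵐ ω ∂P, ω ∉ B₁ → ω ∉ B₂ → ω ∈ G) : ENNReal.ofReal (1 - 3 * δ) ≤ P G := by
  have hcover : Set.univ ≤ᵐ[P] (G ∪ (B₁ ∪ B₂) : Set Ω) := by
    filter_upwards [hG] with ω hω _
    by_cases hb₁ : ω ∈ B₁
    · exact Or.inr (Or.inl hb₁)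
    by_cases hb₂ : ω ∈ B₂
    · exact Or.inr (Or.inr hb₂)
    exact Or.inl (hω hb₁ hb₂)
  have hone : (1 : ENNReal) ≤ P G + ENNReal.ofReal δ := by
    calc (1 : ENNReal) = P Set.univ := measure_univ.symm
      _ ≤ P (G ∪ (B₁ ∪ B₂)) := measure_mono_ae hcover
      _ ≤ P G + (P B₁ + P B₂) :=
          (measure_union_le _ _).trans (by gcongr; exact measure_union_le _ _)
      _ ≤ P G + (ENNReal.ofReal (δ / 2) + ENNReal.ofReal (δ / 2)) := by gcongr
      _ = _ := by rw [← ENNReal.ofReal_add (by positivity) (by positivity), add_halves]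
  calc ENNReal.ofReal (1 - 3 * δ) ≤ ENNReal.ofReal (1 - δ) :=
        ENNReal.ofReal_le_ofReal (by linarith)
    _ = 1 - ENNReal.ofReal δ := by rw [ENNReal.ofReal_sub _ hδ.le, ENNReal.ofReal_one]
    _ ≤ _ := tsub_le_iff_right.2 hone

lemma complexity_term_le {K M β γ s S N : ℝ} (hK : 0 ≤ K) (hM : 0 < M) (hγ : 0 < γ) (hs : 0 ≤ s)
    (hS : 0 ≤ S) :
    60 * K * M ^ (-β) * √M * √(4 * log 2 * s) / (γ * √N) ≤
      120 * K * M ^ ((1 : ℝ) / 2 - β) / (γ * √N) * (√s + S) := by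
  have hlog2 : 0 < log 2 := Real.log_pos one_lt_two
  have h1 : √(4 * log 2 * s) ≤ 2 * √s := by
    rw [show (2 : ℝ) * √s = √(4 * s) by
      rw [Real.sqrt_mul (by norm_num), show (4 : ℝ) = 2 ^ 2 by norm_num,
        Real.sqrt_sq (by norm_num)]]
    refine Real.sqrt_le_sqrt ?_
    nlinarith [log_two_le_one]
  have h2 : 60 * K * M ^ (-β) * √M * √(4 * log 2 * s) / (γ * √N) ≤
      60 * K * M ^ (-β) * √M * (2 * (√s + S)) / (γ * √N) := by
    gcongr
    linarith
  rw [(rpow_scalings hM β).2.2]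
  exact h2.trans (le_of_eq (by ring))

/-- Theorem 4, generalization bound, dimension-free form for convex `σ`. -/
theorem generalization_bound_convex :
    ∃ C : ℝ, 0 < C ∧
      ∀ (A b : ℝ), 0 < A → 0 < b →
      ∀ (d n k : ℕ), 0 < k → 0 < n →
      ∀ (σ : ℝ → ℝ) (K₁ K₂ : ℝ),
        ContDiff ℝ 2 σ →
        (∀ z, |deriv σ z| ≤ K₁) →
        (∀ z, |deriv (deriv σ) z| ≤ K₂) →
        ConvexOn ℝ Set.univ σ → σ 0 = 0 →
      ∀ (μ₀ : Measure (EuclideanSpace ℝ (Fin d))), IsProbabilityMeasure μ₀ →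
        (∀ t : ℝ, 0 < t → μ₀ {θ | t ≤ ‖θ‖} ≤ ENNReal.ofReal (A * Real.exp (-b * t ^ 2))) →
      ∀ (ν : Measure (EuclideanSpace ℝ (Fin d) × ℝ)), IsProbabilityMeasure ν →
      ∀ (ρ : ℝ), 0 < ρ →
      ∀ (v : EuclideanSpace ℝ (Fin d) → EuclideanSpace ℝ (Fin d)),
        Measurable v → (∀ θ, ‖v θ‖ ≤ 1) →
        (∀ᵐ p ∂ν, ‖p.1‖ ≤ 1 ∧ (p.2 = 1 ∨ p.2 = -1) ∧
          ρ ≤ p.2 * ∫ θ, deriv σ ⟪θ, p.1⟫ * ⟪p.1, v θ⟫ ∂μ₀) →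
      ∀ (β γ δ η : ℝ), 0 ≤ β → β < 1 → 0 < γ → 0 < δ → δ < 1 →
        16 * K₁ ^ 2 / ρ ^ 2 * Real.log (2 * n / δ) ≤ (2 * k : ℝ) →
        0 < η →
        η ≤ min ((2 * k : ℝ) ^ β) (4 * (2 * k : ℝ) ^ (2 * β - 1) / (K₁ ^ 2 + K₂)) →
      ∀ (T : ℕ), 0 < T →
        (T : ℝ) ≤ (2 * k : ℝ) * ρ ^ 2 / (32 * η * K₂ ^ 2 * Real.log 2) →
      ENNReal.ofReal (1 - 3 * δ) ≤
        ((Measure.pi fun _ : Fin k => μ₀).prod (Measure.pi fun _ : Fin n => ν))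
          {ω | ∃ t < T,
            (ν {p | p.2 * fnet d (2 * k) β σ (symSigns k)
                (gdSeq d (2 * k) n β σ (symSigns k)
                  (fun i => (ω.2 i).1) (fun i => (ω.2 i).2) η (symInit d k ω.1) t)
                p.1 ≤ 0}).toReal
            ≤ C * (1 + Real.exp γ) *
                (ρ⁻¹ * (T : ℝ) ^ (-(1 / 2) : ℝ) *
                  ((2 * k : ℝ) ^ (β - 1 / 2) * η ^ (-(1 / 2) : ℝ) +
                    Real.sqrt (K₁ ^ 4 + 2 * K₁ ^ 2 * K₂ + K₁ ^ 4 * K₂ ^ 2)))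
              + 3 * Real.sqrt (Real.log (2 / δ) / (2 * n))
              + C * K₁ * (2 * k : ℝ) ^ ((1 : ℝ) / 2 - β) / (γ * Real.sqrt n) *
                  (Real.sqrt (η * T) +
                    Real.sqrt (Real.log (A * (2 * k : ℝ) / δ) / b))} := by
  refine ⟨120, by norm_num, ?_⟩
  intro A b _ _ d n k hk hn σ K₁ K₂ hσ hK₁ hK₂ _ _ μ₀ hμ₀ _ ν hν ρ hρ v hv hv1 hsep β γ δ η
    _ _ hγ hδ hδ1 hkδ hη hη2 T hT0 hT
  have hk' : (0 : ℝ) < k := by exact_mod_cast hk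
  have hT' : (0 : ℝ) < T := by exact_mod_cast hT0
  have hlog2 : 0 < log 2 := Real.log_pos one_lt_two
  have hM : (0 : ℝ) < 2 * k := by positivity
  have hMk : ((2 * k : ℕ) : ℝ) = 2 * k := by push_cast; rfl
  have hK₂0 : 0 < K₂ := by
    refine lt_of_le_of_ne ((abs_nonneg _).trans (hK₂ 0)) fun h => ?_
    rw [← h] at hT
    norm_num at hT
    exact absurd hT hT0.ne'
  obtain ⟨q, hq1, hq2, hq3⟩ := hsep.exists
  have hρK : ρ ≤ K₁ := le_of_separable hK₁ hv1 hq1 hq2 hq3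
  have hK₁0 : 0 < K₁ := hρ.trans_le hρK
  rw [le_div_iff₀ (by positivity)] at hT
  have hstep : η * ((2 * k : ℝ) ^ (-β) * K₂ / 2 + ((2 * k : ℝ) ^ (-β)) ^ 2 * K₁ ^ 2 * (2 * k) / 8)
      ≤ 3 / 4 := by
    refine step_size_bound hM (by positivity) hη hρ hρK hK₂0 ?_ (by exact_mod_cast hT0) hT
    rw [← (rpow_scalings hM β).1]
    exact hη2.trans (min_le_right _ _)
  have hD : 0 ≤ 4 * log 2 * (η * T) := by positivity
  obtain ⟨Δ, hΔ1, hΔ2, hΔ3⟩ := exists_dense_seq_displacement (d := d) (m := 2 * k) hD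
    (by positivity : 0 ≤ 3 * K₁ / K₂)
  have hν1 : ∀ᵐ p ∂ν, ‖p.1‖ ≤ 1 ∧ (p.2 = 1 ∨ p.2 = -1) :=
    hsep.mono fun q hq => ⟨hq.1, hq.2.1⟩
  refine ofReal_one_sub_le_measure hδ
    (measure_prod_not_separated_le hk hn hσ hK₁ hK₁0 hρ hδ hv hv1 hsep hkδ)
    (measure_prod_rampGap_ge_le (β := β) hn hσ hK₁ hK₂ hK₁0 hK₂0 hγ hδ hδ1 hD
      hν1 Δ hΔ1 hΔ2) ?_
  have hae : ∀ᵐ z ∂(Measure.pi fun _ : Fin n => ν), ∀ i,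
      ‖(z i).1‖ ≤ 1 ∧ ((z i).2 = 1 ∨ (z i).2 = -1) :=
    ae_all_iff.2 fun i => (Measure.quasiMeasurePreserving_eval (fun _ : Fin n => ν) i).ae hν1
  filter_upwards [Measure.quasiMeasurePreserving_snd.ae hae] with ω hω hb₁ hb₂
  simp only [not_exists, not_lt, not_le] at hb₁ hb₂
  obtain ⟨t, ht, hle⟩ := exists_misclassification_le (m := 2 * k) (β := β) (ν := ν)
    (Q := √(K₁ ^ 4 + 2 * K₁ ^ 2 * K₂ + K₁ ^ 4 * K₂ ^ 2)) (z := ω.2)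
    (Θ₀ := symInit d k ω.1) (w := fun r => v (symInit d k ω.1 r)) hn (by omega) hσ hK₁ hK₂ hK₁0
    hK₂0 (abs_symSigns (k := k)) (fun i => (hω i).1) (fun i => (hω i).2) hγ hη hρ
    (by rw [hMk]; exact hstep) (fnet_symInit β σ ω.1) (fun r => hv1 _) (fun i => by
      rw [hMk, sum_symInit ω.1 fun θ => deriv σ ⟪θ, (ω.2 i).1⟫ * ⟪(ω.2 i).1, v θ⟫]
      linarith [hb₁ i]) hT0 (by rw [hMk]; linarith) (Real.sqrt_nonneg _) hΔ3
    (fun j => (hb₂ j).le)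
  refine ⟨t, ht, hle.trans ?_⟩
  rw [hMk]
  have hterm := complexity_term_le (β := β) hK₁0.le hM hγ (by positivity : 0 ≤ η * T)
    (Real.sqrt_nonneg (log (A * (2 * k : ℝ) / δ) / b)) (N := n)
  have h0 : 0 ≤ (1 + exp γ) * (ρ⁻¹ * (T : ℝ) ^ (-(1 / 2) : ℝ) * ((2 * k : ℝ) ^ (β - 1 / 2) *
      η ^ (-(1 / 2) : ℝ) + √(K₁ ^ 4 + 2 * K₁ ^ 2 * K₂ + K₁ ^ 4 * K₂ ^ 2))) := by positivity
  linarith
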